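/- arXiv:2204.05228 — 6 statements merged into one kernel-verified Lean document; each statement's English description precedes it below -/
import Mathlib

section
/- Let m ≥ 3 and let i, j, r ∈ {1,…,m} be pairwise distinct. Let π be the permutation of the (m−1)-element set {1,…,m}∖{i} that sends the increasing enumeration of {1,…,m}∖{i} to the enumeration (j, r, followed by the elements of {1,…,m}∖{i,j,r} in increasing order). Then (−1)^{i+1}·sgn(π) = (−1)^{i+j+r+1+θ(r−i)+θ(r−j)+θ(j−i)}. -/
/-- The unit step (Heaviside) function on the integers. -/
def theta (x : ℤ) : ℕ := if 0 < x then 1 else 0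

theorem neg_one_pow_theta_sub (a b : ℕ) :
    (-1 : ℤ) ^ theta ((a : ℤ) - (b : ℤ)) = if b < a then -1 else 1 := by
  unfold theta
  have h : (0 < (a : ℤ) - (b : ℤ)) ↔ b < a := by omega
  simp only [h]
  split_ifs <;> simp

/-- The number of elements below `c`, other than `i`, has the parity of `c + θ(c - i)`. -/
theorem neg_one_pow_card_Iio_erase {m : ℕ} (i c : Fin m) :
    (-1 : ℤ) ^ ((Finset.Iio c).erase i).card
      = (-1) ^ (c : ℕ) * (if i < c then -1 else 1) := by
  rw [Finset.card_erase_eq_ite, Fin.card_Iio]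
  simp only [Finset.mem_Iio]
  split_ifs with h
  · obtain ⟨k, hk⟩ : ∃ k, (c : ℕ) = k + 1 := ⟨c - 1, by have := Fin.lt_def.1 h; omega⟩
    rw [hk, Nat.add_sub_cancel, pow_succ]
    ring
  · simp

/-- The number of elements below `c`, other than `i` and `j`, has the parity of
`c + θ(c - i) + θ(c - j)`. -/
theorem neg_one_pow_card_Iio_erase_erase {m : ℕ} {i j : Fin m} (hij : i ≠ j) (c : Fin m) :
    (-1 : ℤ) ^ (((Finset.Iio c).erase i).erase j).card
      = (-1) ^ (c : ℕ) * (if i < c then -1 else 1) * (if j < c then -1 else 1) := by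
  rw [← neg_one_pow_card_Iio_erase]
  by_cases h : j < c
  · have hmem : j ∈ (Finset.Iio c).erase i := by simp [h, hij.symm]
    rw [← Finset.card_erase_add_one hmem, pow_succ]
    simp [h]
  · rw [Finset.erase_eq_of_notMem (by simp [h])]
    simp [h]

/-- Each row of the inversion product of a permutation is a sign given by the number of
inversions in the row. -/
theorem prod_Ioi_eq_neg_one_pow {n : ℕ} {α : Type*} [LinearOrder α] {f : Fin n → α}
    (hf : Function.Injective f) (x : Fin n) :
    (∏ y ∈ Finset.Ioi x, if f x < f y then (1 : ℤ) else -1)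
      = (-1) ^ ((Finset.Ioi x).filter fun y => f y < f x).card := by
  rw [← Finset.prod_const, Finset.prod_filter]
  refine Finset.prod_congr rfl fun y hy => ?_
  have hne : f x ≠ f y := fun h => (Finset.mem_Ioi.1 hy).ne (hf h)
  rcases lt_or_gt_of_ne hne with h | h
  · simp [h, h.not_gt]
  · simp [h, h.not_gt]

/-- The sign of a permutation whose rows past the first two contain no inversions. -/
theorem sign_trans_symm_eq_of_strictMono_tail {n : ℕ} {α : Type*} [LinearOrder α]
    (e : Fin (n + 2) ≃ α) (o : Fin (n + 2) ≃o α)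
    (hmono : ∀ a b : Fin (n + 2), 2 ≤ (a : ℕ) → a < b → e a < e b) :
    ((Equiv.Perm.sign (e.trans o.toEquiv.symm)) : ℤ)
      = (-1) ^ ((Finset.Ioi (0 : Fin (n + 2))).filter fun y => e y < e 0).card
        * (-1) ^ ((Finset.Ioi (1 : Fin (n + 2))).filter fun y => e y < e 1).card := by
  have hlt : ∀ x y, (e.trans o.toEquiv.symm) x < (e.trans o.toEquiv.symm) y ↔ e x < e y :=
    fun x y => o.symm.lt_iff_lt
  have htail : ∀ k : Fin n, (∏ y ∈ Finset.Ioi k.succ.succ,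
      if e k.succ.succ < e y then (1 : ℤ) else -1) = 1 := fun k =>
    Finset.prod_eq_one fun y hy =>
      if_pos (hmono _ _ (by simp) (Finset.mem_Ioi.1 hy))
  rw [Equiv.Perm.sign_eq_prod_prod_Ioi]
  push_cast
  simp only [hlt, apply_ite (Units.val : ℤˣ → ℤ), Units.val_one, Units.val_neg]
  rw [Fin.prod_univ_succ, Fin.prod_univ_succ, Finset.prod_congr rfl fun k _ => htail k,
    Finset.prod_const_one, mul_one, prod_Ioi_eq_neg_one_pow e.injective,
    prod_Ioi_eq_neg_one_pow e.injective, Fin.succ_zero_eq_one]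

/-- Let `m ≥ 3` and let `i, j, r ∈ {1,…,m}` (encoded as `Fin m`, whose element `a` has 1-based
label `a + 1`) be pairwise distinct.  Let `e` be the enumeration of `{1,…,m}∖{i}` that lists
`j`, then `r`, then the elements of `{1,…,m}∖{i,j,r}` in increasing order, and let `π` be the
permutation carrying the increasing enumeration of `{1,…,m}∖{i}` to `e`.  Then
`(−1)^{i+1}·sgn(π) = (−1)^{i+j+r+1+θ(r−i)+θ(r−j)+θ(j−i)}` (with 1-based labels in the
exponents). -/
theorem sign_crossing_three (m : ℕ) (hm : 3 ≤ m) (i j r : Fin m)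
    (hij : i ≠ j) (hir : i ≠ r) (hjr : j ≠ r)
    (hcard : (Finset.univ \ {i} : Finset (Fin m)).card = m - 1)
    (e : Fin (m - 1) ≃ {x // x ∈ (Finset.univ \ {i} : Finset (Fin m))})
    (he0 : (e ⟨0, by omega⟩ : Fin m) = j)
    (he1 : (e ⟨1, by omega⟩ : Fin m) = r)
    (hmono : ∀ a b : Fin (m - 1), 2 ≤ (a : ℕ) → a < b → (e a : Fin m) < (e b : Fin m)) :
    (-1 : ℤ) ^ (((i : ℕ) + 1) + 1) *
      ((Equiv.Perm.sign
        (e.trans ((Finset.univ \ {i} : Finset (Fin m)).orderIsoOfFin hcard).toEquiv.symm)) : ℤ)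
    = (-1) ^ ((((i : ℕ) + 1) + ((j : ℕ) + 1) + ((r : ℕ) + 1) + 1)
        + theta (((r : ℕ) : ℤ) - ((i : ℕ) : ℤ)) + theta (((r : ℕ) : ℤ) - ((j : ℕ) : ℤ))
        + theta (((j : ℕ) : ℤ) - ((i : ℕ) : ℤ))) := by
  obtain ⟨n, rfl⟩ : ∃ n, m = n + 3 := ⟨m - 3, by omega⟩
  change Fin (n + 2) ≃ _ at e
  change (e 0 : Fin (n + 3)) = j at he0
  change (e 1 : Fin (n + 3)) = r at he1
  have hei : ∀ x, (e x : Fin (n + 3)) ≠ i := fun x =>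
    Finset.notMem_singleton.1 (Finset.mem_sdiff.1 (e x).2).2
  have hsurj : ∀ c, c ≠ i → ∃ x, (e x : Fin (n + 3)) = c := fun c hc =>
    ⟨e.symm ⟨c, by simpa using hc⟩, by simp⟩
  have hinj : Function.Injective fun x => (e x : Fin (n + 3)) :=
    Subtype.val_injective.comp e.injective
  have row0 : ((Finset.Ioi (0 : Fin (n + 2))).filter fun y => e y < e 0).card
      = ((Finset.Iio j).erase i).card := by
    rw [← Finset.card_image_of_injective _ hinj]
    congr 1
    ext c
    simp only [Finset.mem_image, Finset.mem_filter, Finset.mem_Ioi, Finset.mem_erase,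
      Finset.mem_Iio, ← Subtype.coe_lt_coe, he0]
    constructor
    · rintro ⟨x, ⟨-, hx⟩, rfl⟩
      exact ⟨hei x, hx⟩
    · rintro ⟨hc, hlt⟩
      obtain ⟨x, rfl⟩ := hsurj c hc
      refine ⟨x, ⟨Fin.pos_iff_ne_zero.2 ?_, hlt⟩, rfl⟩
      rintro rfl
      exact hlt.ne he0
  have row1 : ((Finset.Ioi (1 : Fin (n + 2))).filter fun y => e y < e 1).card
      = (((Finset.Iio r).erase i).erase j).card := by
    rw [← Finset.card_image_of_injective _ hinj]
    congr 1
    ext c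
    simp only [Finset.mem_image, Finset.mem_filter, Finset.mem_Ioi, Finset.mem_erase,
      Finset.mem_Iio, ← Subtype.coe_lt_coe, he1]
    constructor
    · rintro ⟨x, ⟨hx1, hx⟩, rfl⟩
      refine ⟨fun h => ?_, hei x, hx⟩
      have hx0 : x = 0 := hinj (h.trans he0.symm)
      exact absurd hx1 (by simp [hx0])
    · rintro ⟨hcj, hc, hlt⟩
      obtain ⟨x, rfl⟩ := hsurj c hc
      refine ⟨x, ⟨?_, hlt⟩, rfl⟩
      have hx0 : x ≠ 0 := fun h => hcj (h ▸ he0)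
      have hx1 : x ≠ 1 := fun h => hlt.ne (h ▸ he1)
      rw [Fin.lt_def]
      rw [Ne, Fin.ext_iff] at hx0 hx1
      simp only [Fin.val_zero, Fin.val_one] at hx0 hx1 ⊢
      omega
  have hsign := sign_trans_symm_eq_of_strictMono_tail e
    ((Finset.univ \ {i} : Finset (Fin (n + 3))).orderIsoOfFin hcard) hmono
  rw [row0, row1, neg_one_pow_card_Iio_erase, neg_one_pow_card_Iio_erase_erase hij] at hsign
  refine (congrArg _ hsign).trans ?_
  simp only [pow_add _ _ (theta _), neg_one_pow_theta_sub, ← Fin.lt_def]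
  ring
end

section
/- For pairwise distinct positive integers i, j, r, h, k one has σ_{i,j,r}·σ_{i,j,r,h,k} = −σ_{i,j,h}·σ_{i,j,h,r,k}. -/
/-- `σ_{i,j,r}` for pairwise distinct labels `i j r` (and `0` otherwise). -/
def sigma3 (i j r : ℕ) : ℤ :=
  if i ≠ j ∧ i ≠ r ∧ j ≠ r then
    (-1) ^ (i + j + r + 1 + theta ((r : ℤ) - (i : ℤ)) + theta ((r : ℤ) - (j : ℤ)) +
      theta ((j : ℤ) - (i : ℤ)))
  else 0

/-- `σ_{i,j,r,h,k}` for pairwise distinct labels (and `0` otherwise). -/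
def sigma5 (i j r h k : ℕ) : ℤ :=
  if i ≠ j ∧ i ≠ r ∧ i ≠ h ∧ i ≠ k ∧ j ≠ r ∧ j ≠ h ∧ j ≠ k ∧ r ≠ h ∧ r ≠ k ∧ h ≠ k then
    (-1) ^ (h + k + 1 + theta ((k : ℤ) - (i : ℤ)) + theta ((k : ℤ) - (j : ℤ)) +
      theta ((k : ℤ) - (r : ℤ)) + theta ((k : ℤ) - (h : ℤ)) + theta ((h : ℤ) - (i : ℤ)) +
      theta ((h : ℤ) - (j : ℤ)) + theta ((h : ℤ) - (r : ℤ)))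
  else 0

theorem theta_sub_add_theta_sub_swap {a b : ℤ} (hab : a ≠ b) :
    theta (a - b) + theta (b - a) = 1 := by
  unfold theta
  split_ifs <;> omega

/-- For pairwise distinct positive integers `i, j, r, h, k`:
`σ_{i,j,r}·σ_{i,j,r,h,k} = −σ_{i,j,h}·σ_{i,j,h,r,k}`. -/
theorem sigma3_mul_sigma5_antisymm (i j r h k : ℕ)
    (hi : 0 < i) (hj : 0 < j) (hr : 0 < r) (hh : 0 < h) (hk : 0 < k)
    (hij : i ≠ j) (hir : i ≠ r) (hih : i ≠ h) (hik : i ≠ k)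
    (hjr : j ≠ r) (hjh : j ≠ h) (hjk : j ≠ k)
    (hrh : r ≠ h) (hrk : r ≠ k) (hhk : h ≠ k) :
    sigma3 i j r * sigma5 i j r h k = - (sigma3 i j h * sigma5 i j h r k) := by
  have hswap := theta_sub_add_theta_sub_swap (Nat.cast_injective.ne hrh : (r : ℤ) ≠ h)
  have hneg : (-1 : ℤ) ^ theta ((h : ℤ) - r) = -(-1) ^ theta ((r : ℤ) - h) := by
    obtain ⟨h₁, h₂⟩ | ⟨h₁, h₂⟩ := Nat.add_eq_one_iff.mp hswap <;> simp [h₁, h₂]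
  rw [sigma3, sigma5, sigma3, sigma5, if_pos ⟨hij, hir, hjr⟩,
    if_pos ⟨hij, hir, hih, hik, hjr, hjh, hjk, hrh, hrk, hhk⟩, if_pos ⟨hij, hih, hjh⟩,
    if_pos ⟨hij, hih, hir, hik, hjh, hjr, hjk, hrh.symm, hhk, hrk⟩]
  simp only [pow_add, hneg]
  ring
end

section
/- Let R be a commutative ring, let m be an odd positive integer, and let T be an m×m skew-symmetric matrix over R with zeros on the diagonal. Then for every choice of pairwise distinct i, j, k ∈ {1,…,m}: Σ_{r=1}^{m} σ_{i,j,r} · T_{k,r} · pf_{î,ĵ,r̂}(T) = 0. -/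
open Finset

/-- The successor of `i` in `Fin N` (with wraparound, which is irrelevant in our uses). -/
def finNext {N : ℕ} (i : Fin N) : Fin N :=
  ⟨(i.1 + 1) % N, Nat.mod_lt _ (Nat.lt_of_le_of_lt (Nat.zero_le _) i.2)⟩

/-- The pfaffian of an `N × N` matrix, as the sum over all partitions of `Fin N` into
two-element blocks (encoded by the permutations `σ` with `σ 0 < σ 1`, `σ 2 < σ 3`, …,
`σ 0 < σ 2 < σ 4 < ⋯`) of the sign of the permutation times the product of the entries
of `M` at the blocks.  It is `0` when `N` is odd and `1` when `N = 0`. -/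
noncomputable def pfAux {R : Type*} [CommRing R] {N : ℕ} (M : Matrix (Fin N) (Fin N) R) : R :=
  if N % 2 = 0 then
    ∑ σ ∈ Finset.univ.filter (fun σ : Equiv.Perm (Fin N) =>
        (∀ i : Fin N, (i : ℕ) % 2 = 0 → σ i < σ (finNext i)) ∧
        (∀ i j : Fin N, (i : ℕ) % 2 = 0 → (j : ℕ) % 2 = 0 → i < j → σ i < σ j)),
      ((Equiv.Perm.sign σ : ℤ) : R) *
        ∏ i ∈ Finset.univ.filter (fun i : Fin N => (i : ℕ) % 2 = 0), M (σ i) (σ (finNext i))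
  else 0

/-- The pfaffian of the submatrix of `T` on the rows and columns indexed by the finset `S`
(taken in increasing order). -/
noncomputable def pfSub {R : Type*} [CommRing R] {m : ℕ} (T : Matrix (Fin m) (Fin m) R)
    (S : Finset (Fin m)) : R :=
  pfAux (fun a b : Fin S.card => T ((S.orderIsoOfFin rfl a : Fin m)) ((S.orderIsoOfFin rfl b : Fin m)))

/-- `pfDel T l` is the pfaffian of the submatrix of `T` obtained by deleting the rows and
columns indexed by the list `l`, set to `0` if `l` has a repeated entry. -/
noncomputable def pfDel {R : Type*} [CommRing R] {m : ℕ} (T : Matrix (Fin m) (Fin m) R)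
    (l : List (Fin m)) : R :=
  if l.Nodup then pfSub T (Finset.univ \ l.toFinset) else 0

open CliffordAlgebra ExteriorAlgebra in
/-- Contracting `v₀ ∧ ⋯ ∧ vₙ` by a linear form expands along the factors. -/
theorem contractLeft_ιMulti {R M : Type*} [CommRing R] [AddCommGroup M] [Module R M]
    (d : Module.Dual R M) (n : ℕ) (v : Fin (n + 1) → M) :
    contractLeft (Q := (0 : QuadraticForm R M)) d (ιMulti R (n + 1) v) =
      ∑ p : Fin (n + 1), ((-1 : R) ^ (p : ℕ) * d (v p)) •
        ιMulti R n (fun a => v (p.succAbove a)) := by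
  induction n with
  | zero =>
    rw [ιMulti_succ_apply]
    refine (contractLeft_ι_mul d (v 0) _).trans ?_
    simp
  | succ n ih =>
    rw [ιMulti_succ_apply]
    refine (contractLeft_ι_mul d (v 0) _).trans ?_
    rw [ih, mul_sum, Fin.sum_univ_succ (n := n + 1), sub_eq_add_neg, ← sum_neg_distrib]
    congr 1
    · simp [Matrix.vecTail, Function.comp_def]
    · refine sum_congr rfl fun p _ => ?_
      rw [ιMulti_succ_apply, mul_smul_comm, ← neg_smul]
      simp [Matrix.vecTail, Function.comp_def, pow_succ]

theorem toQuadraticMap_toBilin'_eq_zero {R : Type*} [CommRing R] {m : ℕ}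
    (T : Matrix (Fin m) (Fin m) R) (hskew : ∀ a b, T b a = -T a b) (hdiag : ∀ a, T a a = 0) :
    (Matrix.toBilin' T).toQuadraticMap = 0 := by
  ext x
  rw [LinearMap.BilinMap.toQuadraticMap_apply, Matrix.toBilin'_apply, ← sum_product',
    zero_apply]
  refine sum_involution (fun a _ => (a.2, a.1)) ?_ ?_ (by simp) (by simp)
  · rintro ⟨a, b⟩ _
    simp only
    rw [hskew a b]
    ring
  · rintro ⟨a, b⟩ _ h hab
    obtain rfl : b = a := congrArg Prod.fst hab
    simp [hdiag] at h

section WedgePfaffian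

variable {R M : Type*} [CommRing R] [AddCommGroup M] [Module R M]
  (B : LinearMap.BilinForm R M) (hB : B.toQuadraticMap = 0)

/-- The scalar part of `v₀ * ⋯ * vₙ₋₁`, multiplied in the Clifford-type deformation of the exterior
algebra along the alternating form `B`: the pfaffian of the Gram matrix of `v`, for `-B`. -/
noncomputable def wedgePf (n : ℕ) (v : Fin n → M) : R :=
  ExteriorAlgebra.algebraMapInv
    (CliffordAlgebra.changeForm (Q := 0) (Q' := 0) (B := B) (hB.trans (sub_zero 0).symm)
      (ExteriorAlgebra.ιMulti R n v))

theorem wedgePf_zero (v : Fin 0 → M) : wedgePf B hB 0 v = 1 := by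
  rw [wedgePf, ExteriorAlgebra.ιMulti_zero_apply, CliffordAlgebra.changeForm_one, map_one]

theorem wedgePf_succ_eq_neg_contractLeft (n : ℕ) (v : Fin (n + 1) → M) :
    wedgePf B hB (n + 1) v = -ExteriorAlgebra.algebraMapInv
      (CliffordAlgebra.changeForm (Q := 0) (Q' := 0) (B := B) (hB.trans (sub_zero 0).symm)
        (CliffordAlgebra.contractLeft (B (v 0))
          (ExteriorAlgebra.ιMulti R n (fun a => v a.succ)))) := by
  rw [wedgePf, ExteriorAlgebra.ιMulti_succ_apply, CliffordAlgebra.changeForm_contractLeft]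
  refine (congrArg _ (CliffordAlgebra.changeForm_ι_mul _ (v 0) _)).trans ?_
  rw [map_sub, map_mul]
  have h : ExteriorAlgebra.algebraMapInv
      (CliffordAlgebra.ι (0 : QuadraticForm R M) (v 0)) = 0 :=
    ExteriorAlgebra.lift_ι_apply R _ _ _
  rw [h, zero_mul, zero_sub]
  rfl

theorem wedgePf_one (v : Fin 1 → M) : wedgePf B hB 1 v = 0 := by
  rw [wedgePf_succ_eq_neg_contractLeft, ExteriorAlgebra.ιMulti_zero_apply,
    CliffordAlgebra.contractLeft_one, map_zero, map_zero, neg_zero]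

theorem wedgePf_succ_succ (n : ℕ) (v : Fin (n + 2) → M) :
    wedgePf B hB (n + 2) v = ∑ p : Fin (n + 1), (-1 : R) ^ (p : ℕ) * -B (v 0) (v p.succ) *
      wedgePf B hB n (fun a => v (p.succAbove a).succ) := by
  rw [wedgePf_succ_eq_neg_contractLeft, contractLeft_ιMulti, map_sum, map_sum, ← sum_neg_distrib]
  refine sum_congr rfl fun p _ => ?_
  rw [map_smul, map_smul, smul_eq_mul, mul_neg, neg_mul, wedgePf]

theorem wedgePf_eq_zero_of_not_injective (n : ℕ) (v : Fin n → M) (hv : ¬ Function.Injective v) :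
    wedgePf B hB n v = 0 := by
  rw [wedgePf, ExteriorAlgebra.ιMulti_eq_zero_of_not_inj hv, map_zero, map_zero]

end WedgePfaffian

/-- The permutations of `Fin N` that encode partitions into two-element blocks in `pfAux`. -/
def IsPairing {N : ℕ} (σ : Equiv.Perm (Fin N)) : Prop :=
  (∀ i : Fin N, (i : ℕ) % 2 = 0 → σ i < σ (finNext i)) ∧
    (∀ i j : Fin N, (i : ℕ) % 2 = 0 → (j : ℕ) % 2 = 0 → i < j → σ i < σ j)

/-- The permutation of `Fin (N + 2)` sending `0` to `0`, `1` to `p + 1`, and acting as `τ` on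
the remaining elements, listed increasingly. -/
def addPair {N : ℕ} (p : Fin (N + 1)) (τ : Equiv.Perm (Fin N)) : Equiv.Perm (Fin (N + 2)) :=
  Equiv.Perm.decomposeFin.symm (0, p.cycleRange.symm * Equiv.Perm.decomposeFin.symm (0, τ))

section AddPair

variable {N : ℕ} (p : Fin (N + 1)) (τ : Equiv.Perm (Fin N))

theorem addPair_zero : addPair p τ 0 = 0 := by
  simp [addPair]

theorem addPair_succ_zero : addPair p τ (Fin.succ 0) = p.succ := by
  rw [addPair, Equiv.Perm.decomposeFin_symm_apply_succ]
  simp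

theorem addPair_succ_succ (a : Fin N) : addPair p τ a.succ.succ = (p.succAbove (τ a)).succ := by
  rw [addPair, Equiv.Perm.decomposeFin_symm_apply_succ]
  simp [Equiv.Perm.mul_apply, Equiv.Perm.decomposeFin_symm_apply_succ]

theorem sign_addPair :
    ((Equiv.Perm.sign (addPair p τ) : ℤ)) = (-1) ^ (p : ℕ) * (Equiv.Perm.sign τ : ℤ) := by
  simp [addPair]

theorem addPair_injective : Function.Injective fun x : Fin (N + 1) × Equiv.Perm (Fin N) =>
    addPair x.1 x.2 := by
  rintro ⟨p, τ⟩ ⟨p', τ'⟩ h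
  simp only at h
  obtain rfl : p = p' := by
    have := DFunLike.congr_fun h (Fin.succ 0)
    rwa [addPair_succ_zero, addPair_succ_zero, Fin.succ_inj] at this
  refine Prod.ext rfl (Equiv.ext fun a => ?_)
  have := DFunLike.congr_fun h a.succ.succ
  rwa [addPair_succ_succ, addPair_succ_succ, Fin.succ_inj, Fin.succAbove_right_inj] at this

theorem exists_addPair_eq (σ : Equiv.Perm (Fin (N + 2))) (hσ : σ 0 = 0) :
    ∃ p τ, addPair p τ = σ := by
  have key : ∀ {n : ℕ} (ρ : Equiv.Perm (Fin (n + 1))), ρ 0 = 0 →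
      ∃ ρ', ρ = Equiv.Perm.decomposeFin.symm (0, ρ') := fun {n} ρ h => by
    obtain ⟨⟨q, ρ'⟩, rfl⟩ := Equiv.Perm.decomposeFin.symm.surjective ρ
    obtain rfl : q = 0 := by simpa using h
    exact ⟨ρ', rfl⟩
  obtain ⟨ρ, rfl⟩ := key σ hσ
  obtain ⟨τ, hτ⟩ := key ((ρ 0).cycleRange * ρ) (by simp)
  refine ⟨ρ 0, τ, ?_⟩
  rw [addPair, ← hτ, Equiv.Perm.mul_def, Equiv.Perm.mul_def]
  congr 2
  ext a
  simp

end AddPair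

theorem finNext_zero (N : ℕ) : finNext (0 : Fin (N + 2)) = Fin.succ 0 := by
  ext
  simp [finNext]

theorem finNext_succ_succ {N : ℕ} (hN : N % 2 = 0) (a : Fin N) (ha : (a : ℕ) % 2 = 0) :
    finNext a.succ.succ = (finNext a).succ.succ := by
  have := a.2
  ext
  simp only [finNext, Fin.val_succ]
  rw [Nat.mod_eq_of_lt (by omega), Nat.mod_eq_of_lt (by omega)]

theorem IsPairing.apply_zero {N : ℕ} (hN : N % 2 = 0) {σ : Equiv.Perm (Fin (N + 2))}
    (hσ : IsPairing σ) : σ 0 = 0 := by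
  obtain ⟨x, hx⟩ := σ.surjective 0
  rcases Nat.mod_two_eq_zero_or_one x with h | h
  · rcases eq_or_ne x 0 with rfl | h0
    · exact hx
    · have := hσ.2 0 x (by simp) h (Fin.pos_iff_ne_zero.2 h0)
      rw [hx] at this
      exact absurd this (Fin.not_lt_zero _)
  · have hlt := x.2
    have := hσ.1 ⟨x - 1, by omega⟩ (by simp only; omega)
    have hn : finNext (⟨x - 1, by omega⟩ : Fin (N + 2)) = x := by
      ext
      simp only [finNext]
      rw [Nat.mod_eq_of_lt (by omega)]
      omega
    rw [hn, hx] at this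
    exact absurd this (Fin.not_lt_zero _)

theorem isPairing_addPair {N : ℕ} (hN : N % 2 = 0) (p : Fin (N + 1)) (τ : Equiv.Perm (Fin N)) :
    IsPairing (addPair p τ) ↔ IsPairing τ := by
  have hlt : ∀ a b, addPair p τ (Fin.succ (Fin.succ a)) < addPair p τ (Fin.succ (Fin.succ b)) ↔
      τ a < τ b := fun a b => by
    rw [addPair_succ_succ, addPair_succ_succ, Fin.succ_lt_succ_iff, Fin.succAbove_lt_succAbove_iff]
  have hpar : ∀ a : Fin N, ((a.succ.succ : Fin (N + 2)) : ℕ) % 2 = 0 ↔ (a : ℕ) % 2 = 0 :=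
    fun a => by simp only [Fin.val_succ]; omega
  constructor
  · intro h
    refine ⟨fun i hi => ?_, fun i j hi hj hij => ?_⟩
    · have := h.1 i.succ.succ ((hpar i).2 hi)
      rwa [finNext_succ_succ hN i hi, hlt] at this
    · exact (hlt i j).1 (h.2 _ _ ((hpar i).2 hi) ((hpar j).2 hj) (by simpa using hij))
  · intro h
    refine ⟨fun i => ?_, fun i j => ?_⟩
    · refine Fin.cases ?_ (fun i => Fin.cases ?_ (fun i => ?_) i) i
      · intro _
        rw [finNext_zero, addPair_zero, addPair_succ_zero]
        exact Fin.succ_pos _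
      · simp
      · intro hi
        rw [hpar] at hi
        rw [finNext_succ_succ hN i hi, hlt]
        exact h.1 i hi
    · refine Fin.cases ?_ (fun j => Fin.cases ?_ (fun j => ?_) j) j
      · intro _ _ hij
        exact absurd hij (Fin.not_lt_zero _)
      · simp
      · refine Fin.cases ?_ (fun i => Fin.cases ?_ (fun i => ?_) i) i
        · intro _ _ _
          rw [addPair_zero, addPair_succ_succ]
          exact Fin.succ_pos _
        · simp
        · intro hi hj hij
          rw [hlt]
          exact h.2 i j ((hpar i).1 hi) ((hpar j).1 hj) (by simpa using hij)

/-- Expansion of the pfaffian along the first row. -/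
theorem pfAux_succ_succ {R : Type*} [CommRing R] {N : ℕ}
    (M : Matrix (Fin (N + 2)) (Fin (N + 2)) R) :
    pfAux M = ∑ p : Fin (N + 1), (-1 : R) ^ (p : ℕ) * M 0 p.succ *
      pfAux (fun a b : Fin N => M (p.succAbove a).succ (p.succAbove b).succ) := by
  by_cases hN : N % 2 = 0
  · have hN' : (N + 2) % 2 = 0 := by omega
    simp only [pfAux, if_pos hN, if_pos hN', mul_sum]
    rw [← sum_product', eq_comm]
    refine sum_bij (fun x _ => addPair x.1 x.2) ?_ (fun _ _ _ _ h => addPair_injective h) ?_ ?_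
    · rintro ⟨p, τ⟩ h
      rw [mem_product, mem_filter] at h
      exact mem_filter.2 ⟨mem_univ _, (isPairing_addPair hN p τ).2 h.2.2⟩
    · intro σ h
      have hσ : IsPairing σ := (mem_filter.1 h).2
      obtain ⟨p, τ, rfl⟩ := exists_addPair_eq σ (hσ.apply_zero hN)
      exact ⟨(p, τ), mem_product.2 ⟨mem_univ _, mem_filter.2
        ⟨mem_univ _, (isPairing_addPair hN p τ).1 hσ⟩⟩, rfl⟩
    · rintro ⟨p, τ⟩ _
      simp only
      rw [sign_addPair, prod_filter, prod_filter, Fin.prod_univ_succ, Fin.prod_univ_succ,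
        finNext_zero, addPair_zero, addPair_succ_zero]
      have hprod : ∀ a : Fin N,
          (if ((a.succ.succ : Fin (N + 2)) : ℕ) % 2 = 0 then
            M (addPair p τ a.succ.succ) (addPair p τ (finNext a.succ.succ)) else 1) =
          if (a : ℕ) % 2 = 0 then
            M (p.succAbove (τ a)).succ (p.succAbove (τ (finNext a))).succ else 1 := fun a => by
        have hpar : ((a.succ.succ : Fin (N + 2)) : ℕ) % 2 = 0 ↔ (a : ℕ) % 2 = 0 := by
          simp only [Fin.val_succ]; omega
        by_cases ha : (a : ℕ) % 2 = 0
        · rw [if_pos ha, if_pos (hpar.2 ha), finNext_succ_succ hN a ha, addPair_succ_succ,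
            addPair_succ_succ]
        · rw [if_neg ha, if_neg (mt hpar.1 ha)]
      rw [prod_congr rfl fun a _ => hprod a]
      simp
      ring
  · simp [pfAux, hN]

theorem pfAux_eq_wedgePf {R M : Type*} [CommRing R] [AddCommGroup M] [Module R M]
    (B : LinearMap.BilinForm R M) (hB : B.toQuadraticMap = 0) :
    ∀ (n : ℕ) (v : Fin n → M), pfAux (fun a b => -B (v a) (v b)) = wedgePf B hB n v
  | 0, v => by
    rw [wedgePf_zero]
    simp [pfAux]
  | 1, v => by
    rw [wedgePf_one]
    simp [pfAux]
  | n + 2, v => by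
    rw [wedgePf_succ_succ]
    exact (pfAux_succ_succ _).trans
      (sum_congr rfl fun p _ => congrArg _ (pfAux_eq_wedgePf B hB n _))

/-- A pfaffian whose first row repeats another row vanishes; expanded along the first row. -/
theorem sum_neg_one_pow_mul_pfAux_eq_zero {R : Type*} [CommRing R] {m : ℕ}
    (T : Matrix (Fin m) (Fin m) R) (hskew : ∀ a b, T b a = -T a b) (hdiag : ∀ a, T a a = 0)
    {n : ℕ} (e : Fin (n + 1) → Fin m) (q : Fin (n + 1)) :
    ∑ p : Fin (n + 1), (-1 : R) ^ (p : ℕ) * T (e q) (e p) *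
      pfAux (fun a b => T (e (p.succAbove a)) (e (p.succAbove b))) = 0 := by
  have hB := toQuadraticMap_toBilin'_eq_zero (-T)
    (fun a b => by rw [Matrix.neg_apply, Matrix.neg_apply, hskew a b])
    (fun a => by rw [Matrix.neg_apply, hdiag, neg_zero])
  let w : Fin (n + 2) → Fin m := Fin.cons (e q) e
  have h := wedgePf_eq_zero_of_not_injective _ hB (n + 2)
    (fun a => Pi.single (w a) (1 : R)) fun hinj => by
      have := hinj (a₁ := 0) (a₂ := q.succ) (by simp [w])
      exact (Fin.succ_ne_zero q).symm this
  rw [← pfAux_eq_wedgePf] at h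
  replace h := (pfAux_succ_succ _).symm.trans h
  simpa only [Matrix.toBilin'_single, Matrix.neg_apply, neg_neg, w, Fin.cons_zero, Fin.cons_succ] using h

theorem pfSub_eq_pfAux {R : Type*} [CommRing R] {m n : ℕ} (T : Matrix (Fin m) (Fin m) R)
    (S : Finset (Fin m)) (hS : S.card = n) (f : Fin n → Fin m) (hf : StrictMono f)
    (hfS : ∀ a, f a ∈ S) : pfSub T S = pfAux (fun a b => T (f a) (f b)) := by
  subst hS
  rw [orderEmbOfFin_unique rfl hfS hf]
  rfl

theorem val_eq_val_add_card_compl {m n : ℕ} (e : Fin n → Fin m) (he : StrictMono e) (p : Fin n)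
    (i j : Fin m) (hij : i ≠ j) (hS : ∀ x, (∃ a, e a = x) ↔ x ≠ i ∧ x ≠ j) :
    (e p : ℕ) = p + ((if i < e p then 1 else 0) + if j < e p then 1 else 0) := by
  have hcard : (Iio (e p)).card = (e p : ℕ) := Fin.card_Iio _
  have hU : Iio (e p) = (Iio p).image e ∪ ({i, j} : Finset (Fin m)).filter (· < e p) := by
    ext x
    simp only [mem_Iio, mem_union, mem_image, mem_filter, mem_insert, mem_singleton]
    constructor
    · intro hx
      by_cases h : x = i ∨ x = j
      · exact Or.inr ⟨h, hx⟩
      · obtain ⟨a, rfl⟩ := (hS x).2 (not_or.1 h)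
        exact Or.inl ⟨a, he.lt_iff_lt.1 hx, rfl⟩
    · rintro (⟨a, ha, rfl⟩ | h)
      · exact he ha
      · exact h.2
  rw [← hcard, hU, card_union_of_disjoint, card_image_of_injective _ he.injective, Fin.card_Iio,
    card_filter, sum_pair hij]
  rw [disjoint_left]
  intro x hx hx'
  obtain ⟨a, _, rfl⟩ := mem_image.1 hx
  have := (hS (e a)).1 ⟨a, rfl⟩
  simp only [mem_filter, mem_insert, mem_singleton] at hx'
  exact hx'.1.elim this.1 this.2

/-- Knuth-type pfaffian identity: for a skew-symmetric `m × m` matrix `T` (`m` odd) with zero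
diagonal, and pairwise distinct `i, j, k ∈ {1,…,m}` (encoded in `Fin m`, an element `a`
carrying the 1-based label `a + 1`):
`Σ_{r=1}^{m} σ_{i,j,r} · T_{k,r} · pf_{î,ĵ,r̂}(T) = 0`. -/
theorem sum_sigma3_mul_pf_eq_zero {R : Type*} [CommRing R] (m : ℕ) (hodd : Odd m) (hpos : 0 < m)
    (T : Matrix (Fin m) (Fin m) R)
    (hskew : ∀ a b, T b a = - T a b) (hdiag : ∀ a, T a a = 0)
    (i j k : Fin m) (hij : i ≠ j) (hik : i ≠ k) (hjk : j ≠ k) :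
    ∑ r : Fin m, ((sigma3 ((i : ℕ) + 1) ((j : ℕ) + 1) ((r : ℕ) + 1) : ℤ) : R) *
      T k r * pfDel T [i, j, r] = 0 := by
  obtain ⟨S, hSdef⟩ : ∃ S : Finset (Fin m), S = univ \ {i, j} := ⟨_, rfl⟩
  have hmem : ∀ x, x ∈ S ↔ x ≠ i ∧ x ≠ j := by simp [hSdef]
  have hkS : k ∈ S := (hmem k).2 ⟨hik.symm, hjk.symm⟩
  obtain ⟨n, hn⟩ : ∃ n, S.card = n + 1 := Nat.exists_eq_succ_of_ne_zero (card_ne_zero_of_mem hkS)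
  obtain ⟨e, he, hrange⟩ : ∃ e : Fin (n + 1) → Fin m, StrictMono e ∧ ∀ x, (∃ a, e a = x) ↔ x ∈ S :=
    ⟨S.orderEmbOfFin hn, (S.orderEmbOfFin hn).strictMono,
      fun x => Set.ext_iff.1 (S.range_orderEmbOfFin hn) x⟩
  obtain ⟨q, rfl⟩ := (hrange k).2 hkS
  have hsum : ∑ r : Fin m, ((sigma3 ((i : ℕ) + 1) ((j : ℕ) + 1) ((r : ℕ) + 1) : ℤ) : R) *
      T (e q) r * pfDel T [i, j, r] =
      ∑ p : Fin (n + 1), ((sigma3 ((i : ℕ) + 1) ((j : ℕ) + 1) ((e p : ℕ) + 1) : ℤ) : R) *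
      T (e q) (e p) * pfDel T [i, j, e p] := by
    rw [← sum_subset (subset_univ S), ← sum_image (f := fun r : Fin m =>
      ((sigma3 ((i : ℕ) + 1) ((j : ℕ) + 1) ((r : ℕ) + 1) : ℤ) : R) *
      T (e q) r * pfDel T [i, j, r]) he.injective.injOn]
    · refine sum_congr (ext fun x => ?_) fun _ _ => rfl
      simp [← hrange]
    · intro r _ hr
      have : ¬ [i, j, r].Nodup := by
        rw [hmem] at hr
        simp
        tauto
      rw [pfDel, if_neg this, mul_zero]
  have hterm : ∀ p : Fin (n + 1),
      ((sigma3 ((i : ℕ) + 1) ((j : ℕ) + 1) ((e p : ℕ) + 1) : ℤ) : R) *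
        T (e q) (e p) * pfDel T [i, j, e p] =
      (-1 : R) ^ ((i : ℕ) + j + if i < j then 1 else 0) * ((-1 : R) ^ (p : ℕ) * T (e q) (e p) *
        pfAux (fun a b => T (e (p.succAbove a)) (e (p.succAbove b)))) := by
    intro p
    have hp := (hmem _).1 ((hrange _).1 ⟨p, rfl⟩)
    have hpf : pfDel T [i, j, e p] =
        pfAux (fun a b => T (e (p.succAbove a)) (e (p.succAbove b))) := by
      have hnd : [i, j, e p].Nodup := by
        simp [hij, hp.1.symm, hp.2.symm]
      have hset : (univ : Finset (Fin m)) \ [i, j, e p].toFinset = S.erase (e p) := by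
        ext x
        simp [hmem]
        tauto
      rw [pfDel, if_pos hnd, hset]
      refine pfSub_eq_pfAux T _ ?_ (fun a => e (p.succAbove a))
        (he.comp (Fin.strictMono_succAbove p)) fun a => ?_
      · rw [card_erase_of_mem ((hrange _).1 ⟨p, rfl⟩), hn, Nat.add_sub_cancel]
      · exact mem_erase.2 ⟨fun h => Fin.succAbove_ne p a (he.injective h), (hrange _).1 ⟨_, rfl⟩⟩
    have hval := val_eq_val_add_card_compl e he p i j hij fun x => (hrange x).trans (hmem x)
    have hsign : sigma3 ((i : ℕ) + 1) ((j : ℕ) + 1) ((e p : ℕ) + 1) =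
        (-1) ^ (((i : ℕ) + j + if i < j then 1 else 0) + p) := by
      have h1 : (i : ℕ) ≠ j := Fin.val_ne_of_ne hij
      have h2 : (i : ℕ) ≠ e p := Fin.val_ne_of_ne hp.1.symm
      have h3 : (j : ℕ) ≠ e p := Fin.val_ne_of_ne hp.2.symm
      rw [sigma3, if_pos (by omega)]
      refine neg_one_pow_congr ?_
      simp only [theta, Fin.lt_def] at hval ⊢
      rw [Nat.even_iff, Nat.even_iff]
      split_ifs at hval ⊢ <;> omega
    rw [hpf, hsign]
    push_cast
    ring
  rw [hsum, sum_congr rfl fun p _ => hterm p, ← mul_sum,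
    sum_neg_one_pow_mul_pfAux_eq_zero T hskew hdiag e q, mul_zero]
end

section
/- Let R be a commutative ring, m an odd positive integer, T an m×m skew-symmetric matrix over R with zeros on the diagonal, and c_{i,j,l} ∈ R for 1 ≤ i,j ≤ m, 1 ≤ l ≤ 3. Then for all distinct i, j ∈ {1,…,m} the following three elements of R are equal: Σ_{r=1, r≠j}^{m} c_{r,j,3} d^{j,i,r}_{1,2}, −Σ_{r=1, r≠j}^{m} c_{r,j,2} d^{j,i,r}_{1,3}, and Σ_{r=1, r≠j}^{m} c_{r,j,1} d^{j,i,r}_{2,3}. -/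
open Finset

/-- `y_i := (−1)^{i+1} pf_{î}(T)` (1-based label `i + 1` for `i : Fin m`). -/
noncomputable def yPf {R : Type*} [CommRing R] {m : ℕ} (T : Matrix (Fin m) (Fin m) R)
    (i : Fin m) : R :=
  (-1 : R) ^ (((i : ℕ) + 1) + 1) * pfDel T [i]

/-- `d^k_{α,β} := Σ_i Σ_r σ_{i,k,r} c_{i,k,β} c_{r,k,α} pf_{î,k̂,r̂}(T)`, where the last
index of `c` is 0-based (`0,1,2` standing for `1,2,3`). -/
noncomputable def dTop {R : Type*} [CommRing R] {m : ℕ} (T : Matrix (Fin m) (Fin m) R)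
    (c : Fin m → Fin m → Fin 3 → R) (k : Fin m) (α β : Fin 3) : R :=
  ∑ i : Fin m, ∑ r : Fin m,
    ((sigma3 ((i : ℕ) + 1) ((k : ℕ) + 1) ((r : ℕ) + 1) : ℤ) : R) *
      c i k β * c r k α * pfDel T [i, k, r]

/-- `d^{k,i,j}_{α,β} := Σ_r σ_{i,j,r} Σ_h σ_{i,j,r,h,k} pf_{î,ĵ,r̂,ĥ,k̂}(T) c_{r,k,β} c_{h,k,α}`,
where the last index of `c` is 0-based (`0,1,2` standing for `1,2,3`). -/
noncomputable def dTop3 {R : Type*} [CommRing R] {m : ℕ} (T : Matrix (Fin m) (Fin m) R)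
    (c : Fin m → Fin m → Fin 3 → R) (k i j : Fin m) (α β : Fin 3) : R :=
  ∑ r : Fin m, ((sigma3 ((i : ℕ) + 1) ((j : ℕ) + 1) ((r : ℕ) + 1) : ℤ) : R) *
    ∑ h : Fin m,
      ((sigma5 ((i : ℕ) + 1) ((j : ℕ) + 1) ((r : ℕ) + 1) ((h : ℕ) + 1) ((k : ℕ) + 1) : ℤ) : R) *
        pfDel T [i, j, r, h, k] * c r k β * c h k α

theorem theta_sub_swap {a b : ℕ} (h : a ≠ b) :
    (theta ((a : ℤ) - b) = 1 ∧ theta ((b : ℤ) - a) = 0) ∨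
      (theta ((a : ℤ) - b) = 0 ∧ theta ((b : ℤ) - a) = 1) := by
  unfold theta
  rcases lt_or_gt_of_ne h with h | h
  · right
    constructor
    · rw [if_neg (by omega)]
    · rw [if_pos (by omega)]
  · left
    constructor
    · rw [if_pos (by omega)]
    · rw [if_neg (by omega)]

theorem sigma3_mul_sigma5_swap_left (i r s h j : ℕ) :
    sigma3 i s r * sigma5 i s r h j = -(sigma3 i r s * sigma5 i r s h j) := by
  by_cases hd : i ≠ r ∧ i ≠ s ∧ i ≠ h ∧ i ≠ j ∧ r ≠ s ∧ r ≠ h ∧ r ≠ j ∧ s ≠ h ∧ s ≠ j ∧ h ≠ j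
  · unfold sigma3 sigma5
    rw [if_pos (by grind), if_pos (by grind), if_pos (by grind), if_pos (by grind)]
    rcases theta_sub_swap (a := r) (b := s) (by grind) with ⟨h₁, h₂⟩ | ⟨h₁, h₂⟩ <;>
      rw [h₁, h₂] <;> ring
  · have hz : sigma5 i r s h j = 0 := if_neg hd
    have hz' : sigma5 i s r h j = 0 := if_neg (by grind)
    rw [hz, hz', mul_zero, mul_zero, neg_zero]

theorem sigma3_mul_sigma5_swap_right (i r s h j : ℕ) :
    sigma3 i r h * sigma5 i r h s j = -(sigma3 i r s * sigma5 i r s h j) := by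
  by_cases hd : i ≠ r ∧ i ≠ s ∧ i ≠ h ∧ i ≠ j ∧ r ≠ s ∧ r ≠ h ∧ r ≠ j ∧ s ≠ h ∧ s ≠ j ∧ h ≠ j
  · unfold sigma3 sigma5
    rw [if_pos (by grind), if_pos (by grind), if_pos (by grind), if_pos (by grind)]
    rcases theta_sub_swap (a := s) (b := h) (by grind) with ⟨h₁, h₂⟩ | ⟨h₁, h₂⟩ <;>
      rw [h₁, h₂] <;> ring
  · have hz : sigma5 i r s h j = 0 := if_neg hd
    have hz' : sigma5 i r h s j = 0 := if_neg (by grind)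
    rw [hz, hz', mul_zero, mul_zero, neg_zero]

theorem pfDel_perm {R : Type*} [CommRing R] {m : ℕ} (T : Matrix (Fin m) (Fin m) R)
    {l l' : List (Fin m)} (h : l.Perm l') : pfDel T l = pfDel T l' := by
  unfold pfDel
  rw [List.toFinset_eq_of_perm _ _ h]
  simp only [h.nodup_iff]

/-- The coefficient of `c r j γ * c s j β * c h j α` in `∑ r, c r j γ * dTop3 T c j i r α β`. -/
noncomputable def tripleCoeff {R : Type*} [CommRing R] {m : ℕ} (T : Matrix (Fin m) (Fin m) R)
    (i j r s h : Fin m) : R :=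
  ((sigma3 ((i : ℕ) + 1) ((r : ℕ) + 1) ((s : ℕ) + 1) *
    sigma5 ((i : ℕ) + 1) ((r : ℕ) + 1) ((s : ℕ) + 1) ((h : ℕ) + 1) ((j : ℕ) + 1) : ℤ) : R) *
      pfDel T [i, r, s, h, j]

section tripleCoeff

variable {R : Type*} [CommRing R] {m : ℕ} (T : Matrix (Fin m) (Fin m) R)

theorem tripleCoeff_swap_left (i j r s h : Fin m) :
    tripleCoeff T i j s r h = -tripleCoeff T i j r s h := by
  unfold tripleCoeff
  rw [sigma3_mul_sigma5_swap_left, Int.cast_neg, neg_mul,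
    pfDel_perm T ((List.Perm.swap r s [h, j]).cons i)]

theorem tripleCoeff_swap_right (i j r s h : Fin m) :
    tripleCoeff T i j r h s = -tripleCoeff T i j r s h := by
  unfold tripleCoeff
  rw [sigma3_mul_sigma5_swap_right, Int.cast_neg, neg_mul,
    pfDel_perm T (((List.Perm.swap s h [j]).cons r).cons i)]

theorem tripleCoeff_rotate (i j r s h : Fin m) :
    tripleCoeff T i j h r s = tripleCoeff T i j r s h := by
  rw [tripleCoeff_swap_left, tripleCoeff_swap_right, neg_neg]

theorem sum_mul_dTop3 (c : Fin m → Fin m → Fin 3 → R) (i j : Fin m) (α β γ : Fin 3) :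
    ∑ r ∈ Finset.univ.filter (fun r : Fin m => r ≠ j), c r j γ * dTop3 T c j i r α β =
      ∑ r, ∑ s, ∑ h, tripleCoeff T i j r s h * (c r j γ * c s j β * c h j α) := by
  have hterm (r : Fin m) : c r j γ * dTop3 T c j i r α β =
      ∑ s, ∑ h, tripleCoeff T i j r s h * (c r j γ * c s j β * c h j α) := by
    simp only [dTop3, tripleCoeff, Finset.mul_sum, Int.cast_mul]
    exact Finset.sum_congr rfl fun s _ => Finset.sum_congr rfl fun h _ => by ring
  rw [Finset.sum_filter_of_ne]
  · exact Finset.sum_congr rfl fun r _ => hterm r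
  · rintro r - hr rfl
    refine hr ?_
    rw [hterm]
    refine Finset.sum_eq_zero fun s _ => Finset.sum_eq_zero fun h _ => ?_
    simp [tripleCoeff, pfDel]

end tripleCoeff

/-- For a skew-symmetric `m × m` matrix `T` (`m` odd) with zero diagonal, arbitrary scalars
`c_{i,j,l}` (last index encoded 0-based by `Fin 3`), and distinct `i, j ∈ {1,…,m}`, the three
elements
`Σ_{r≠j} c_{r,j,3} d^{j,i,r}_{1,2}`, `−Σ_{r≠j} c_{r,j,2} d^{j,i,r}_{1,3}`, and
`Σ_{r≠j} c_{r,j,1} d^{j,i,r}_{2,3}` are equal. -/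
theorem trimming_res_productE_welldef {R : Type*} [CommRing R] (m : ℕ) (hodd : Odd m)
    (hpos : 0 < m) (T : Matrix (Fin m) (Fin m) R)
    (hskew : ∀ a b, T b a = - T a b) (hdiag : ∀ a, T a a = 0)
    (c : Fin m → Fin m → Fin 3 → R) (i j : Fin m) (hij : i ≠ j) :
    (∑ r ∈ Finset.univ.filter (fun r : Fin m => r ≠ j), c r j 2 * dTop3 T c j i r 0 1
      = - ∑ r ∈ Finset.univ.filter (fun r : Fin m => r ≠ j), c r j 1 * dTop3 T c j i r 0 2) ∧
    (∑ r ∈ Finset.univ.filter (fun r : Fin m => r ≠ j), c r j 2 * dTop3 T c j i r 0 1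
      = ∑ r ∈ Finset.univ.filter (fun r : Fin m => r ≠ j), c r j 0 * dTop3 T c j i r 1 2) := by
  simp only [sum_mul_dTop3]
  constructor
  · rw [Finset.sum_comm, ← Finset.sum_neg_distrib]
    refine Finset.sum_congr rfl fun r _ => ?_
    rw [← Finset.sum_neg_distrib]
    refine Finset.sum_congr rfl fun s _ => ?_
    rw [← Finset.sum_neg_distrib]
    refine Finset.sum_congr rfl fun h _ => ?_
    rw [tripleCoeff_swap_left]
    ring
  · symm
    rw [Finset.sum_comm]
    refine Finset.sum_congr rfl fun r _ => ?_
    rw [Finset.sum_comm]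
    refine Finset.sum_congr rfl fun s _ => Finset.sum_congr rfl fun h _ => ?_
    rw [tripleCoeff_rotate]
    ring
end

section
/- Let R be a commutative ring and let c_{a,b,l} ∈ R for a, b ∈ {1,…,5} and l ∈ {1,2,3}. Let i, k ∈ {1,…,5} be distinct and let r, h, s be an enumeration of the three-element set {1,…,5}∖{i,k}. Then σ_{i,r,h}σ_{i,r,h,s,k}·c_{r,k,3}(c_{s,k,1}c_{h,k,2} − c_{h,k,1}c_{s,k,2}) + σ_{i,h,r}σ_{i,h,r,s,k}·c_{h,k,3}(c_{s,k,1}c_{r,k,2} − c_{r,k,1}c_{s,k,2}) + σ_{i,s,r}σ_{i,s,r,h,k}·c_{s,k,3}(c_{h,k,1}c_{r,k,2} − c_{r,k,1}c_{h,k,2}) = −σ_{i,r,h}σ_{i,r,h,s,k}·det M, where M is the 3×3 matrix with rows (c_{h,k,1}, c_{s,k,1}, c_{r,k,1}), (c_{h,k,2}, c_{s,k,2}, c_{r,k,2}), (c_{h,k,3}, c_{s,k,3}, c_{r,k,3}). -/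
theorem neg_one_pow_theta_sub_comm {a b : ℕ} (hab : a ≠ b) :
    (-1 : ℤ) ^ theta ((a : ℤ) - b) = -(-1) ^ theta ((b : ℤ) - a) := by
  unfold theta
  split_ifs <;> omega

theorem sigma3_mul_sigma5_swap_two_three {i r h s k : ℕ} (hrh : r ≠ h) :
    sigma3 i h r * sigma5 i h r s k = -(sigma3 i r h * sigma5 i r h s k) := by
  by_cases hd : i ≠ r ∧ i ≠ h ∧ i ≠ s ∧ i ≠ k ∧ r ≠ s ∧ r ≠ k ∧ h ≠ s ∧ h ≠ k ∧ s ≠ k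
  · obtain ⟨hir, hih, his, hik, hrs, hrk, hhs, hhk, hsk⟩ := hd
    simp only [sigma3, sigma5, ne_eq, hir, hih, his, hik, hrh, hrh.symm, hrs, hrk, hhs, hhk, hsk,
      not_false_eq_true, and_self, if_true, pow_add, neg_one_pow_theta_sub_comm hrh]
    ring
  · rw [sigma5, sigma5, if_neg (by tauto), if_neg (by tauto), mul_zero, mul_zero, neg_zero]

theorem sigma3_mul_sigma5_swap_three_four {i r h s k : ℕ} (hhs : h ≠ s) :
    sigma3 i r s * sigma5 i r s h k = -(sigma3 i r h * sigma5 i r h s k) := by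
  by_cases hd : i ≠ r ∧ i ≠ h ∧ i ≠ s ∧ i ≠ k ∧ r ≠ h ∧ r ≠ s ∧ r ≠ k ∧ h ≠ k ∧ s ≠ k
  · obtain ⟨hir, hih, his, hik, hrh, hrs, hrk, hhk, hsk⟩ := hd
    simp only [sigma3, sigma5, ne_eq, hir, hih, his, hik, hrh, hhs, hhs.symm, hrs, hrk, hhk, hsk,
      not_false_eq_true, and_self, if_true, pow_add, neg_one_pow_theta_sub_comm hhs]
    ring
  · rw [sigma5, sigma5, if_neg (by tauto), if_neg (by tauto), mul_zero, mul_zero, neg_zero]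

/-- The computational content of Lemma 5.3 of the paper (for `m = 5`): the signed combination
of `2×2` minors equals (up to the sign `−σ_{i,r,h}σ_{i,r,h,s,k}`) the `3×3` determinant.
Indices in `{1,…,5}` are encoded by `Fin 5`, an element `a` carrying the 1-based label `a + 1`;
the last index of `c` is encoded 0-based by `Fin 3`. -/
theorem trim_minor_det_identity {R : Type*} [CommRing R] (c : Fin 5 → Fin 5 → Fin 3 → R)
    (i k : Fin 5) (hik : i ≠ k) (r h s : Fin 5)
    (hrh : r ≠ h) (hrs : r ≠ s) (hhs : h ≠ s)
    (hri : r ≠ i) (hrk : r ≠ k) (hhi : h ≠ i) (hhk : h ≠ k) (hsi : s ≠ i) (hsk : s ≠ k) :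
    ((sigma3 ((i : ℕ) + 1) ((r : ℕ) + 1) ((h : ℕ) + 1) *
        sigma5 ((i : ℕ) + 1) ((r : ℕ) + 1) ((h : ℕ) + 1) ((s : ℕ) + 1) ((k : ℕ) + 1) : ℤ) : R) *
      (c r k 2 * (c s k 0 * c h k 1 - c h k 0 * c s k 1))
    + ((sigma3 ((i : ℕ) + 1) ((h : ℕ) + 1) ((r : ℕ) + 1) *
        sigma5 ((i : ℕ) + 1) ((h : ℕ) + 1) ((r : ℕ) + 1) ((s : ℕ) + 1) ((k : ℕ) + 1) : ℤ) : R) *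
      (c h k 2 * (c s k 0 * c r k 1 - c r k 0 * c s k 1))
    + ((sigma3 ((i : ℕ) + 1) ((s : ℕ) + 1) ((r : ℕ) + 1) *
        sigma5 ((i : ℕ) + 1) ((s : ℕ) + 1) ((r : ℕ) + 1) ((h : ℕ) + 1) ((k : ℕ) + 1) : ℤ) : R) *
      (c s k 2 * (c h k 0 * c r k 1 - c r k 0 * c h k 1))
    = - ((sigma3 ((i : ℕ) + 1) ((r : ℕ) + 1) ((h : ℕ) + 1) *
        sigma5 ((i : ℕ) + 1) ((r : ℕ) + 1) ((h : ℕ) + 1) ((s : ℕ) + 1) ((k : ℕ) + 1) : ℤ) : R) *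
      Matrix.det !![c h k 0, c s k 0, c r k 0;
                    c h k 1, c s k 1, c r k 1;
                    c h k 2, c s k 2, c r k 2] := by
  have label_ne {a b : Fin 5} (hab : a ≠ b) : (a : ℕ) + 1 ≠ (b : ℕ) + 1 := by omega
  rw [sigma3_mul_sigma5_swap_two_three (label_ne hrh),
    sigma3_mul_sigma5_swap_two_three (label_ne hrs),
    sigma3_mul_sigma5_swap_three_four (label_ne hhs), Matrix.det_fin_three]
  generalize sigma3 _ _ _ * sigma5 _ _ _ _ _ = S
  simp
  ring
end

section
/- Let (R, 𝔪, 𝕜) be a regular local ring of Krull dimension 3 whose maximal ideal 𝔪 is generated by z₁, z₂, z₃. Let m ≥ 5 be an odd integer, let T be an m×m skew-symmetric matrix with zero diagonal and entries in 𝔪, set y_i := (−1)^{i+1} pf_{î}(T), and let I = (y₁,…,y_m). Assume the Buchsbaum–Eisenbud complex 0 → R →^{D₁ᵀ} R^m →^{T} R^m →^{D₁} R with D₁ = (y₁, …, y_m) is exact in positive degrees (a free resolution of R/I). Fix 1 ≤ t ≤ m and let J := y₁𝔪 + ⋯ + y_t𝔪 + (y_{t+1},…,y_m). Choose c_{i,j,l}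 ∈ R with T_{j,i} = Σ_{l=1}^{3} c_{i,j,l} z_l, and let Q̄ be the 3t×m matrix over 𝕜 = R/𝔪 whose entry in row (k,l) (1 ≤ k ≤ t, 1 ≤ l ≤ 3) and column i is the residue class of c_{i,k,l}, with ρ := rank(Q̄). Then the Betti numbers of R/J over R are: dim_𝕜 Tor₀^R(R/J, 𝕜) = 1, dim_𝕜 Tor₁^R(R/J, 𝕜) = m + 2t − ρ, dim_𝕜 Tor₂^R(R/J, 𝕜) = m + 3t − ρ, dim_𝕜 Tor₃^R(R/J, 𝕜) = 1 + t, and Tor_q^R(R/J, 𝕜) = 0 for q ≥ 4; that is, J is a perfect ideal of grade 3 of format (1, m + 2t − ρ, m + 3t − ρ, 1 + t). -/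
open Finset

open CategoryTheory

/-- The trimmed ideal `J = y₁𝔪 + ⋯ + y_t𝔪 + (y_{t+1},…,y_m)` (an element `a : Fin m` carries
the 1-based label `a + 1`). -/
noncomputable def trimIdeal {R : Type*} [CommRing R] [IsLocalRing R] (m t : ℕ)
    (T : Matrix (Fin m) (Fin m) R) : Ideal R :=
  (⨆ k : {k : Fin m // (k : ℕ) < t},
      Ideal.span {yPf T k.1} * IsLocalRing.maximalIdeal R) ⊔
    Ideal.span ((fun i => yPf T i) '' {i : Fin m | t ≤ (i : ℕ)})

open IsLocalRing in
/-- Every element of the ideal generated by a finite family that lies outside `𝔪²` can replace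
one of the generators. -/
lemma exists_maximalIdeal_eq_span_sup {R : Type*} [CommRing R] [IsLocalRing R] {n : ℕ}
    (z : Fin (n + 1) → R) (hz : maximalIdeal R = Ideal.span (Set.range z))
    {x : R} (hx : x ∈ maximalIdeal R) (hx2 : x ∉ maximalIdeal R ^ 2) :
    ∃ i : Fin (n + 1),
      maximalIdeal R = Ideal.span {x} ⊔ Ideal.span (Set.range (z ∘ i.succAbove)) := by
  have hzm : ∀ i, z i ∈ maximalIdeal R := fun i => hz ▸ Ideal.subset_span ⟨i, rfl⟩
  obtain ⟨a, ha⟩ := (Submodule.mem_span_range_iff_exists_fun R).1 (hz ▸ hx)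
  obtain ⟨i, hi⟩ : ∃ i, IsUnit (a i) := by
    by_contra! hcon
    refine hx2 (ha ▸ Ideal.sum_mem _ fun i _ => ?_)
    rw [pow_two]
    exact Ideal.mul_mem_mul ((mem_maximalIdeal _).2 (hcon i)) (hzm i)
  refine ⟨i, le_antisymm ?_ ?_⟩
  · rw [hz, Ideal.span_le]
    have hrest : ∀ j, j ≠ i → z j ∈ Ideal.span {x} ⊔ Ideal.span (Set.range (z ∘ i.succAbove)) := by
      intro j hj
      obtain ⟨k, rfl⟩ := Fin.exists_succAbove_eq hj
      exact Ideal.mem_sup_right (Ideal.subset_span ⟨k, rfl⟩)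
    rintro _ ⟨j, rfl⟩
    by_cases hj : j = i
    · subst hj
      rw [SetLike.mem_coe, ← Ideal.unit_mul_mem_iff_mem _ hi]
      have hsum : a j * z j = x - ∑ k : Fin n, a (j.succAbove k) * z (j.succAbove k) := by
        rw [← ha, Fin.sum_univ_succAbove _ j]
        simp
      rw [hsum]
      refine Ideal.sub_mem _ (Ideal.mem_sup_left (Ideal.mem_span_singleton_self x))
        (Ideal.sum_mem _ fun k _ => Ideal.mul_mem_left _ _ (hrest _ (Fin.succAbove_ne _ _)))
    · exact hrest j hj
  · refine sup_le ?_ ?_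
    · rwa [Ideal.span_singleton_le_iff_mem]
    · rw [Ideal.span_le]
      rintro _ ⟨k, rfl⟩
      exact hzm _

open IsLocalRing in
/-- Passing to the quotient by a generator of the maximal ideal drops the number of generators
and the dimension by one. -/
lemma maximalIdeal_quotient_span_singleton {R : Type*} [CommRing R] [IsNoetherianRing R]
    [IsLocalRing R] {n : ℕ} (x : R) (w : Fin n → R)
    (hm : maximalIdeal R = Ideal.span {x} ⊔ Ideal.span (Set.range w))
    (hdim : ((n + 1 : ℕ) : WithBot ℕ∞) ≤ ringKrullDim R) :
    ∃ _ : IsLocalRing (R ⧸ Ideal.span {x}),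
      maximalIdeal (R ⧸ Ideal.span {x}) =
        Ideal.span (Set.range fun i => Ideal.Quotient.mk (Ideal.span {x}) (w i)) ∧
      (n : WithBot ℕ∞) ≤ ringKrullDim (R ⧸ Ideal.span {x}) := by
  have hx : x ∈ maximalIdeal R := hm ▸ Ideal.mem_sup_left (Ideal.mem_span_singleton_self x)
  have hne : Ideal.span {x} ≠ ⊤ := fun h =>
    (maximalIdeal.isMaximal R).ne_top (top_le_iff.1 (h ▸ (Ideal.span_singleton_le_iff_mem _).2 hx))
  have : Nontrivial (R ⧸ Ideal.span {x}) := Ideal.Quotient.nontrivial_iff.2 hne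
  have hloc : IsLocalRing (R ⧸ Ideal.span {x}) :=
    IsLocalRing.of_surjective' _ (Ideal.Quotient.mk_surjective (I := Ideal.span {x}))
  refine ⟨hloc, ?_, ?_⟩
  · rw [← map_maximalIdeal_of_surjective (Ideal.Quotient.mk (Ideal.span {x}))
      Ideal.Quotient.mk_surjective, hm, Ideal.map_sup, Ideal.map_quotient_self, bot_sup_eq,
      Ideal.map_span, ← Set.range_comp]
    rfl
  · have h := ringKrullDim_le_ringKrullDim_quotient_add_encard (R := R) {x} (by
      rw [IsLocalRing.ringJacobson_eq_maximalIdeal]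
      simpa using hx)
    have h2 := hdim.trans h
    rw [Set.encard_singleton] at h2
    revert h2
    generalize ringKrullDim (R ⧸ Ideal.span {x}) = d
    intro h2
    induction d with
    | bot => simp at h2
    | coe d =>
      have h3 : ((n + 1 : ℕ) : ℕ∞) ≤ d + 1 := by exact_mod_cast h2
      push_cast at h3
      have h4 : (n : ℕ∞) ≤ d := by
        simpa using h3
      exact_mod_cast h4

open IsLocalRing in
/-- A regular local ring is an integral domain. -/
lemma isDomain_of_maximalIdeal_eq_span {n : ℕ} : ∀ {R : Type*} [CommRing R] [IsNoetherianRing R]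
    [IsLocalRing R] (z : Fin n → R), maximalIdeal R = Ideal.span (Set.range z) →
    (n : WithBot ℕ∞) ≤ ringKrullDim R → IsDomain R := by
  induction n with
  | zero =>
    intro R _ _ _ z hz _
    have : IsField R := isField_iff_maximalIdeal_eq.2 (by simpa using hz)
    exact this.isDomain
  | succ n ih =>
    intro R _ _ _ z hz hdim
    have hpos : ¬ ringKrullDim R = 0 := by
      intro h
      rw [h] at hdim
      have : n + 1 ≤ 0 := by exact_mod_cast hdim
      omega
    have hJ : maximalIdeal R ≤ (⊥ : Ideal R).jacobson := by
      rw [jacobson_eq_maximalIdeal _ bot_ne_top]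
    have hfield : maximalIdeal R ≠ ⊥ := fun h =>
      hpos (ringKrullDim_eq_zero_of_isField (isField_iff_maximalIdeal_eq.2 h))
    obtain ⟨x, hx, hx2, hxp⟩ : ∃ x ∈ maximalIdeal R, x ∉ maximalIdeal R ^ 2 ∧
        ∀ p ∈ minimalPrimes R, x ∉ p := by
      by_contra! hcon
      have hfin := minimalPrimes.finite_of_isNoetherianRing R
      have hsub := (Ideal.subset_union_prime (s := insert (maximalIdeal R ^ 2) hfin.toFinset)
        (f := id) (maximalIdeal R ^ 2) (maximalIdeal R ^ 2) (by
          intro i hi hia _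
          have : i ∈ minimalPrimes R := by simpa [hia] using hi
          exact this.1.1) (I := maximalIdeal R)).1 (by
          intro x hx
          by_cases hx2 : x ∈ maximalIdeal R ^ 2
          · exact Set.mem_biUnion (x := maximalIdeal R ^ 2) (by simp) hx2
          · obtain ⟨p, hp, hxp⟩ := hcon x hx hx2
            exact Set.mem_biUnion (x := p) (by simp [hp]) hxp)
      obtain ⟨p, hp, hle⟩ := hsub
      simp only [Finset.mem_insert, Set.Finite.mem_toFinset] at hp
      rcases hp with rfl | hp
      · refine hfield (Submodule.eq_bot_of_le_smul_of_le_jacobson_bot (maximalIdeal R) _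
          (IsNoetherian.noetherian _) ?_ hJ)
        simpa [pow_two] using hle
      · have : maximalIdeal R ∈ minimalPrimes R := by
          have := hp.1.1
          rwa [le_antisymm hle (le_maximalIdeal this.ne_top)]
        apply hpos
        rw [← maximalIdeal_height_eq_ringKrullDim, Ideal.height_eq_zero_iff.2 this]
        rfl
    obtain ⟨i, hi⟩ := exists_maximalIdeal_eq_span_sup z hz hx hx2
    obtain ⟨_, hm, hd⟩ := maximalIdeal_quotient_span_singleton x _ hi hdim
    have hdom := ih _ hm hd
    have hprime : (Ideal.span {x}).IsPrime := (Ideal.Quotient.isDomain_iff_prime _).1 hdom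
    obtain ⟨p, hp, hple⟩ := Ideal.exists_minimalPrimes_le (bot_le : (⊥ : Ideal R) ≤ Ideal.span {x})
    have hpp : p.IsPrime := hp.1.1
    have hbot : p = ⊥ := by
      refine Submodule.eq_bot_of_le_smul_of_le_jacobson_bot (maximalIdeal R) _
          (IsNoetherian.noetherian _) ?_ hJ
      intro y hy
      obtain ⟨r, rfl⟩ := Ideal.mem_span_singleton'.1 (hple hy)
      rw [mul_comm]
      exact Ideal.mul_mem_mul hx ((hpp.mem_or_mem hy).resolve_right (hxp p hp))
    subst hbot
    exact IsDomain.of_bot_isPrime R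

open IsLocalRing in
/-- A minimal generating system of the maximal ideal is linearly independent modulo `𝔪²`. -/
lemma mem_maximalIdeal_of_sum_mul_mem_sq {R : Type*} [CommRing R] [IsNoetherianRing R]
    [IsLocalRing R] {n : ℕ} (z : Fin (n + 1) → R)
    (hz : maximalIdeal R = Ideal.span (Set.range z))
    (hdim : ((n + 1 : ℕ) : WithBot ℕ∞) ≤ ringKrullDim R)
    (a : Fin (n + 1) → R) (ha : ∑ i, a i * z i ∈ maximalIdeal R ^ 2) (i : Fin (n + 1)) :
    a i ∈ maximalIdeal R := by
  by_contra hi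
  replace hi : IsUnit (a i) := by simpa using hi
  have hle : maximalIdeal R ≤ Ideal.span (Set.range (z ∘ i.succAbove)) := by
    refine Submodule.le_of_le_smul_of_le_jacobson_bot (I := maximalIdeal R)
      (IsNoetherian.noetherian _) (jacobson_eq_maximalIdeal _ bot_ne_top).ge ?_
    refine hz.trans_le (Ideal.span_le.2 ?_)
    rw [smul_eq_mul, ← pow_two]
    have hrest : ∀ k, z (i.succAbove k) ∈
        Ideal.span (Set.range (z ∘ i.succAbove)) ⊔ maximalIdeal R ^ 2 := fun k =>
      Ideal.mem_sup_left (Ideal.subset_span ⟨k, rfl⟩)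
    rintro _ ⟨j, rfl⟩
    by_cases hj : j = i
    · subst hj
      rw [SetLike.mem_coe, ← Ideal.unit_mul_mem_iff_mem _ hi]
      rw [Fin.sum_univ_succAbove _ j] at ha
      rw [← add_sub_cancel_right (a j * z j) (∑ k, a (j.succAbove k) * z (j.succAbove k))]
      exact Ideal.sub_mem _ (Ideal.mem_sup_right ha)
        (Ideal.sum_mem _ fun k _ => Ideal.mul_mem_left _ _ (hrest k))
    · obtain ⟨k, rfl⟩ := Fin.exists_succAbove_eq hj
      exact hrest k
  have heq : maximalIdeal R = Ideal.span (Set.range (z ∘ i.succAbove)) := by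
    refine le_antisymm hle ?_
    rw [hz]
    exact Ideal.span_mono (Set.range_comp_subset_range _ _)
  have h1 := hdim.trans (ringKrullDim_le_spanFinrank_maximalIdeal R)
  have h2 : (maximalIdeal R).spanFinrank ≤ n := by
    rw [heq]
    refine (Submodule.spanFinrank_span_le_ncard_of_finite (Set.finite_range _)).trans ?_
    rw [← Nat.card_coe_set_eq]
    exact (Finite.card_range_le _).trans (by simp)
  have h3 : n + 1 ≤ (maximalIdeal R).spanFinrank := by exact_mod_cast h1
  omega

open IsLocalRing in
/-- A minimal generator of the maximal ideal of a regular local ring is a nonzerodivisor. -/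
lemma eq_zero_of_generator_mul_eq_zero {R : Type*} [CommRing R] [IsNoetherianRing R]
    [IsLocalRing R] {n : ℕ} (z : Fin (n + 1) → R)
    (hz : maximalIdeal R = Ideal.span (Set.range z))
    (hdim : ((n + 1 : ℕ) : WithBot ℕ∞) ≤ ringKrullDim R) (i : Fin (n + 1)) {a : R}
    (ha : z i * a = 0) : a = 0 := by
  have := isDomain_of_maximalIdeal_eq_span z hz hdim
  refine (mul_eq_zero.1 ha).resolve_left fun h0 => ?_
  have h1 := mem_maximalIdeal_of_sum_mul_mem_sq z hz hdim (Pi.single i 1) (by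
    rw [Finset.sum_eq_single i] <;> simp +contextual [h0]) i
  simp at h1

open IsLocalRing in
/-- Three generators of the maximal ideal of a three-dimensional local ring form a regular
sequence. -/
lemma regular_generators_three {R : Type*} [CommRing R] [IsNoetherianRing R] [IsLocalRing R]
    (z : Fin 3 → R) (hz : maximalIdeal R = Ideal.span (Set.range z))
    (hdim : ((3 : ℕ) : WithBot ℕ∞) ≤ ringKrullDim R) :
    (∀ a, z 0 * a = 0 → a = 0) ∧
    (∀ a b, z 1 * a = z 0 * b → ∃ d, a = z 0 * d) ∧
    (∀ a b c, z 2 * a = z 0 * b + z 1 * c → ∃ d e, a = z 0 * d + z 1 * e) := by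
  have h0 : maximalIdeal R = Ideal.span {z 0} ⊔ Ideal.span (Set.range ![z 1, z 2]) := by
    rw [hz, ← Ideal.span_union]
    congr 1
    ext x
    simp [Fin.exists_fin_succ, eq_comm (b := x)]
    tauto
  obtain ⟨_, hm1, hd1⟩ := maximalIdeal_quotient_span_singleton _ _ h0 hdim
  have h1 : maximalIdeal (R ⧸ Ideal.span {z 0}) =
      Ideal.span {Ideal.Quotient.mk (Ideal.span {z 0}) (z 1)} ⊔
        Ideal.span (Set.range ![Ideal.Quotient.mk (Ideal.span {z 0}) (z 2)]) := by
    rw [hm1, ← Ideal.span_union]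
    congr 1
    ext x
    simp [Fin.exists_fin_succ, eq_comm (b := x)]
    tauto
  obtain ⟨_, hm2, hd2⟩ := maximalIdeal_quotient_span_singleton _ _ h1 hd1
  have hz2 : ∀ x, z 0 ∣ x ↔ Ideal.Quotient.mk (Ideal.span {z 0}) x = 0 := fun x => by
    rw [Ideal.Quotient.eq_zero_iff_mem, Ideal.mem_span_singleton]
  refine ⟨fun a ha => eq_zero_of_generator_mul_eq_zero z hz hdim 0 ha, fun a b hab => ?_,
    fun a b c habc => ?_⟩
  · refine (hz2 a).2 (eq_zero_of_generator_mul_eq_zero _ hm1 hd1 0 ?_)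
    simpa [← map_mul] using (hz2 _).1 ⟨b, hab⟩
  · have hA : Ideal.Quotient.mk (Ideal.span {z 0}) (z 2 * a - z 1 * c) = 0 :=
      (hz2 _).1 ⟨b, by rw [habc]; ring⟩
    have hB : Ideal.Quotient.mk (Ideal.span {Ideal.Quotient.mk (Ideal.span {z 0}) (z 1)})
        (Ideal.Quotient.mk (Ideal.span {z 0}) a) = 0 := by
      refine eq_zero_of_generator_mul_eq_zero _ hm2 hd2 0 ?_
      simp only [Matrix.cons_val_fin_one]
      rw [← map_mul, Ideal.Quotient.eq_zero_iff_mem, Ideal.mem_span_singleton]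
      refine ⟨Ideal.Quotient.mk (Ideal.span {z 0}) c, ?_⟩
      rw [← sub_eq_zero, ← map_mul, ← map_mul, ← map_sub]
      exact hA
    rw [Ideal.Quotient.eq_zero_iff_mem, Ideal.mem_span_singleton] at hB
    obtain ⟨e, he⟩ := hB
    obtain ⟨e, rfl⟩ := Ideal.Quotient.mk_surjective e
    obtain ⟨d, hd⟩ := (hz2 (a - z 1 * e)).2 (by rw [map_sub, map_mul, he, sub_self])
    exact ⟨d, e, by rw [← hd]; ring⟩

/-- Exactness of the Koszul complex on a regular sequence of length three. -/
lemma koszul_exact_three {R : Type*} [CommRing R] (z : Fin 3 → R)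
    (h0 : ∀ a, z 0 * a = 0 → a = 0)
    (h1 : ∀ a b, z 1 * a = z 0 * b → ∃ d, a = z 0 * d)
    (h2 : ∀ a b c, z 2 * a = z 0 * b + z 1 * c → ∃ d e, a = z 0 * d + z 1 * e) :
    (∀ r : Fin 3 → R, ∑ l, r l * z l = 0 → ∃ v : Fin 3 → R, r = crossProduct v z) ∧
    (∀ v : Fin 3 → R, crossProduct v z = 0 → ∃ s : R, v = s • z) := by
  have hc : ∀ a b, z 0 * a = z 0 * b → a = b := fun a b h =>
    sub_eq_zero.1 (h0 _ (by rw [mul_sub, h, sub_self]))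
  constructor
  · intro r hr
    rw [Fin.sum_univ_three] at hr
    obtain ⟨d, e, hde⟩ := h2 (r 2) (-r 0) (-r 1) (by linear_combination hr)
    obtain ⟨f, hf⟩ := h1 (r 1 + z 2 * e) (-r 0 - z 2 * d) (by
      linear_combination hr - z 2 * hde)
    have h3 : r 0 = -z 2 * d - z 1 * f := hc _ _ (by
      linear_combination hr - z 2 * hde - z 1 * hf)
    refine ⟨![e, -d, f], ?_⟩
    rw [cross_apply]
    funext i
    fin_cases i
    · simp; linear_combination h3
    · simp; linear_combination hf
    · simp; linear_combination hde
  · intro v hv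
    rw [cross_apply] at hv
    have e0 := congr_fun hv 0
    have e1 := congr_fun hv 1
    have e2 := congr_fun hv 2
    simp at e0 e1 e2
    obtain ⟨s, hs⟩ := h1 (v 0) (v 1) (by linear_combination e2)
    refine ⟨s, ?_⟩
    funext i
    fin_cases i
    · simp; linear_combination hs
    · simp; exact hc _ _ (by linear_combination z 1 * hs - e2)
    · simp; exact hc _ _ (by linear_combination z 2 * hs + e1)

section TorDimensionShift

universe u

variable {R : Type u} [CommRing R]

open MonoidalCategory in
/-- Tensoring a short exact sequence of modules with a complex of flat modules gives a short exact
sequence of complexes. -/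
lemma shortExact_tensor_complex {N F M : ModuleCat.{u} R} (f : N ⟶ F) (g : F ⟶ M)
    (w : f ≫ g = 0) (hS : (ShortComplex.mk f g w).ShortExact)
    (K : ChainComplex (ModuleCat.{u} R) ℕ) (hK : ∀ i, Module.Flat R (K.X i)) :
    (ShortComplex.mk
      ((NatTrans.mapHomologicalComplex ((tensoringLeft (ModuleCat.{u} R)).map f)
        (ComplexShape.down ℕ)).app K)
      ((NatTrans.mapHomologicalComplex ((tensoringLeft (ModuleCat.{u} R)).map g)
        (ComplexShape.down ℕ)).app K)
      (by
        ext i : 1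
        change f ▷ K.X i ≫ g ▷ K.X i = 0
        rw [← comp_whiskerRight, w, MonoidalPreadditive.zero_whiskerRight])).ShortExact := by
  refine HomologicalComplex.shortExact_of_degreewise_shortExact _ fun i => ?_
  have := hK i
  exact hS.map_of_exact (tensorRight (K.X i))

open MonoidalCategory in
/-- `Tor` computed from a projective resolution of the second argument. -/
noncomputable def torIsoHomology (M Y : ModuleCat.{u} R) (P : ProjectiveResolution Y) (n : ℕ) :
    ((Tor (ModuleCat.{u} R) n).obj M).obj Y ≅
      ((((tensoringLeft (ModuleCat.{u} R)).obj M).mapHomologicalComplex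
        (ComplexShape.down ℕ)).obj P.complex).homology n :=
  P.isoLeftDerivedObj _ n

open MonoidalCategory in
/-- The higher homology of a flat module tensored with a projective resolution vanishes. -/
lemma isZero_homology_tensor_resolution (F Y : ModuleCat.{u} R) [Module.Flat R F]
    (P : ProjectiveResolution Y) (n : ℕ) :
    Limits.IsZero (((((tensoringLeft (ModuleCat.{u} R)).obj F).mapHomologicalComplex
      (ComplexShape.down ℕ)).obj P.complex).homology (n + 1)) := by
  refine HomologicalComplex.ExactAt.isZero_homology ?_
  have h : (P.complex.sc (n + 1)).Exact := P.complex_exactAt_succ n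
  exact h.map (tensorLeft F)

/-- Higher `Tor` vanishes on flat modules. -/
lemma isZero_Tor_succ_of_flat (F Y : ModuleCat.{u} R) [Module.Flat R F] (n : ℕ) :
    Limits.IsZero (((Tor (ModuleCat.{u} R) (n + 1)).obj F).obj Y) :=
  (isZero_homology_tensor_resolution F Y (projectiveResolution Y) n).of_iso
    (torIsoHomology F Y _ (n + 1))

lemma flat_projectiveResolution {Y : ModuleCat.{u} R} (P : ProjectiveResolution Y) (i : ℕ) :
    Module.Flat R (P.complex.X i) := by
  have h : Projective (ModuleCat.of R (P.complex.X i)) := P.projective i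
  have : Module.Projective R (P.complex.X i) := (IsProjective.iff_projective _).2 h
  infer_instance

/-- Dimension shifting for `Tor` in the first argument. -/
lemma nonempty_Tor_succ_succ_iso {N F M : ModuleCat.{u} R} (f : N ⟶ F) (g : F ⟶ M)
    (w : f ≫ g = 0) (hS : (ShortComplex.mk f g w).ShortExact) [Module.Flat R F]
    (Y : ModuleCat.{u} R) (n : ℕ) :
    Nonempty (((Tor (ModuleCat.{u} R) (n + 2)).obj M).obj Y ≅
      ((Tor (ModuleCat.{u} R) (n + 1)).obj N).obj Y) := by
  let P := projectiveResolution Y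
  have hE := shortExact_tensor_complex f g w hS P.complex (flat_projectiveResolution P)
  exact ⟨torIsoHomology M Y P (n + 2) ≪≫
    hE.δIso (n + 2) (n + 1) (by simp) (isZero_homology_tensor_resolution F Y P (n + 1))
      (isZero_homology_tensor_resolution F Y P n) ≪≫ (torIsoHomology N Y P (n + 1)).symm⟩

/-- Exactness of a short complex of modules, transported along isomorphisms of its terms. -/
lemma function_exact_of_iso {A B C A' B' C' : ModuleCat.{u} R} (α : A ≅ A') (β : B ≅ B')
    (γ : C ≅ C') {f : A ⟶ B} {g : B ⟶ C} {w : f ≫ g = 0} (h : (ShortComplex.mk f g w).Exact) :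
    Function.Exact (α.inv ≫ f ≫ β.hom) (β.inv ≫ g ≫ γ.hom) :=
  (ShortComplex.ShortExact.moduleCat_exact_iff_function_exact
    (ShortComplex.mk (α.inv ≫ f ≫ β.hom) (β.inv ≫ g ≫ γ.hom) (by
      simp only [Category.assoc, Iso.hom_inv_id_assoc]
      rw [← Category.assoc f g, w, Limits.zero_comp, Limits.comp_zero]))).1
    (ShortComplex.exact_of_iso (ShortComplex.isoMk α β γ (by simp) (by simp)) h)

open MonoidalCategory in
/-- The low-degree part of the long exact sequence of `Tor` in the first argument, written with
modules isomorphic to the tensor products. -/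
lemma exists_Tor_one_exact {N F M : ModuleCat.{u} R} (f : N ⟶ F) (g : F ⟶ M)
    (w : f ≫ g = 0) (hS : (ShortComplex.mk f g w).ShortExact) [Module.Flat R F]
    (Y : ModuleCat.{u} R) :
    ∃ (a : ((Tor (ModuleCat.{u} R) 1).obj M).obj Y ⟶ N ⊗ Y) (b : N ⊗ Y ⟶ F ⊗ Y)
      (c : F ⊗ Y ⟶ M ⊗ Y), Function.Injective a ∧ Function.Exact a b ∧ Function.Exact b c ∧
        Function.Surjective c := by
  let P := projectiveResolution Y
  have hE := shortExact_tensor_complex f g w hS P.complex (flat_projectiveResolution P)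
  let e (X : ModuleCat.{u} R) :=
    (torIsoHomology X Y P 0).symm ≪≫ ((tensorLeft X).leftDerivedZeroIsoSelf.app Y)
  have hmono := hE.mono_δ 1 0 (by simp) (isZero_homology_tensor_resolution F Y P 0)
  have h1 := hE.homology_exact₁ 1 0 (by simp)
  have h2 := hE.homology_exact₂ 0
  let ψ := (NatTrans.mapHomologicalComplex ((tensoringLeft (ModuleCat.{u} R)).map g)
    (ComplexShape.down ℕ)).app P.complex
  have hepi : Epi ψ := hE.epi_g
  have h3 := HomologicalComplex.epi_homologyMap_of_epi_of_not_rel ψ 0 (by simp)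
  refine ⟨(torIsoHomology M Y P 1).symm.inv ≫ hE.δ 1 0 (by simp) ≫ (e N).hom,
    (e N).inv ≫ HomologicalComplex.homologyMap
      ((NatTrans.mapHomologicalComplex ((tensoringLeft (ModuleCat.{u} R)).map f)
        (ComplexShape.down ℕ)).app P.complex) 0 ≫ (e F).hom,
    (e F).inv ≫ HomologicalComplex.homologyMap ψ 0 ≫ (e M).hom,
    (ModuleCat.mono_iff_injective _).1 inferInstance, function_exact_of_iso _ _ _ h1,
    function_exact_of_iso _ _ _ h2, (ModuleCat.epi_iff_surjective _).1 inferInstance⟩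

end TorDimensionShift

section ResidueFieldVectorSpaces

open IsLocalRing TensorProduct

variable {R : Type*} [CommRing R] [IsLocalRing R]

lemma length_fin_residueField (n : ℕ) :
    Module.length R (Fin n → ResidueField R) = n := by
  have h : IsSimpleModule R (ResidueField R) :=
    isSimpleModule_iff_isCoatom.2 (Ideal.isMaximal_def.1 (maximalIdeal.isMaximal R))
  rw [Module.length_pi, Module.length_eq_one]
  simp

/-- An `R`-submodule of a finite power of the residue field is again such a power. -/
lemma exists_submodule_equiv_fin (n : ℕ) (S : Submodule R (Fin n → ResidueField R)) :
    ∃ d : ℕ, Nonempty (S ≃ₗ[R] (Fin d → ResidueField R)) := by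
  let S' : Submodule (ResidueField R) (Fin n → ResidueField R) :=
    { S with
      smul_mem' := by
        intro a x hx
        obtain ⟨r, rfl⟩ := residue_surjective a
        exact S.smul_mem r hx }
  exact ⟨_, ⟨(Module.finBasis (ResidueField R) S').equivFun.restrictScalars R⟩⟩

/-- The kernel of a map of vector spaces over the residue field, by counting lengths. -/
lemma nonempty_equiv_fin_of_exact {X A B C : Type*} [AddCommGroup X] [AddCommGroup A]
    [AddCommGroup B] [AddCommGroup C] [Module R X] [Module R A] [Module R B] [Module R C]
    (a : X →ₗ[R] A) (b : A →ₗ[R] B) (c : B →ₗ[R] C) (ha : Function.Injective a)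
    (hab : Function.Exact a b) (hbc : Function.Exact b c) (hc : Function.Surjective c)
    {d p n q : ℕ} (eA : A ≃ₗ[R] (Fin n → ResidueField R))
    (eB : B ≃ₗ[R] (Fin p → ResidueField R)) (eC : C ≃ₗ[R] (Fin q → ResidueField R))
    (h : d + p = n + q) : Nonempty (X ≃ₗ[R] (Fin d → ResidueField R)) := by
  obtain ⟨d', ⟨e⟩⟩ := exists_submodule_equiv_fin n (LinearMap.range (eA.toLinearMap ∘ₗ a))
  let eX := (LinearEquiv.ofInjective (eA.toLinearMap ∘ₗ a) (eA.injective.comp ha)).trans e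
  have h1 := Module.length_eq_add_of_exact a b.rangeRestrict ha b.surjective_rangeRestrict
    (by
      intro x
      rw [← hab x]
      exact Subtype.ext_iff)
  have h2 := Module.length_eq_add_of_exact (LinearMap.range b).subtype c
    (Submodule.subtype_injective _) hc (by
      intro x
      rw [hbc x]
      simp)
  rw [eA.length_eq, eX.length_eq, length_fin_residueField, length_fin_residueField] at h1
  rw [eB.length_eq, eC.length_eq, length_fin_residueField, length_fin_residueField] at h2
  obtain ⟨r, hr⟩ : ∃ r : ℕ, Module.length R (LinearMap.range b) = r := by
    refine ⟨_, (ENat.natCast_toNat fun htop => ?_).symm⟩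
    simp [htop] at h2
  rw [hr] at h1 h2
  norm_cast at h1 h2
  obtain rfl : d = d' := by omega
  exact ⟨eX⟩

/-- The base change to the residue field of a module presented by a free module, in terms of the
image of the relations in the vector space of coefficients. -/
lemma nonempty_tensor_residueField_equiv {ι C : Type*} [Fintype ι] [AddCommGroup C] [Module R C]
    (g : (ι → R) →ₗ[R] C) (hg : Function.Surjective g)
    (W : Submodule (ResidueField R) (ι → ResidueField R))
    (h1 : ∀ x, g x = 0 → (fun i => residue R (x i)) ∈ W)
    (h2 : ∀ w ∈ W, ∃ x, g x = 0 ∧ ∀ i, residue R (x i) = w i)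
    {n : ℕ} (hn : n + Module.finrank (ResidueField R) W = Fintype.card ι) :
    Nonempty ((C ⊗[R] ResidueField R) ≃ₗ[R] (Fin n → ResidueField R)) := by
  let p : (ι → R) →ₗ[R] (ι → ResidueField R) ⧸ W :=
    (W.mkQ.restrictScalars R) ∘ₗ (Algebra.linearMap R (ResidueField R)).compLeft ι
  have hp : Function.Surjective p := by
    refine W.mkQ_surjective.comp fun w => ?_
    choose x hx using fun i => residue_surjective (w i)
    exact ⟨x, funext hx⟩
  let q : (ι → R) →ₗ[R] C ⧸ (maximalIdeal R • (⊤ : Submodule R C)) := Submodule.mkQ _ ∘ₗ g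
  have hq : Function.Surjective q := (Submodule.mkQ_surjective _).comp hg
  have hker : LinearMap.ker q = LinearMap.ker p := by
    ext x
    have hpx : p x = 0 ↔ (fun i => residue R (x i)) ∈ W := Submodule.Quotient.mk_eq_zero W
    have hqx : q x = 0 ↔ g x ∈ maximalIdeal R • (⊤ : Submodule R C) :=
      Submodule.Quotient.mk_eq_zero _
    have hm : ∀ y : ι → R, (∀ i, y i ∈ maximalIdeal R) →
        g y ∈ maximalIdeal R • (⊤ : Submodule R C) := by
      classical
      intro y hy
      rw [pi_eq_sum_univ y, map_sum]
      refine Submodule.sum_mem _ fun i _ => ?_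
      rw [map_smul]
      exact Submodule.smul_mem_smul (hy i) trivial
    rw [LinearMap.mem_ker, LinearMap.mem_ker, hpx, hqx]
    constructor
    · intro hx
      have hx' : ∃ y : ι → R, (∀ i, y i ∈ maximalIdeal R) ∧ g y = g x := by
        refine Submodule.smul_induction_on (p := fun c => ∃ y : ι → R,
          (∀ i, y i ∈ maximalIdeal R) ∧ g y = c) hx ?_ ?_
        · rintro r hr c -
          obtain ⟨y, rfl⟩ := hg c
          exact ⟨r • y, fun i => Ideal.mul_mem_right _ _ hr, map_smul _ _ _⟩
        · rintro _ _ ⟨y, hy, rfl⟩ ⟨y', hy', rfl⟩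
          exact ⟨y + y', fun i => add_mem (hy i) (hy' i), map_add _ _ _⟩
      obtain ⟨y, hy, hyx⟩ := hx'
      convert h1 (x - y) (by rw [map_sub, hyx, sub_self]) using 2 with i
      rw [Pi.sub_apply, map_sub, (residue_eq_zero_iff _).2 (hy i), sub_zero]
    · intro hx
      obtain ⟨y, hy, hyx⟩ := h2 _ hx
      have := hm (x - y) fun i => by
        rw [← residue_eq_zero_iff, Pi.sub_apply, map_sub, hyx, sub_self]
      rwa [map_sub, hy, sub_zero] at this
  have hfin : Module.finrank (ResidueField R) ((ι → ResidueField R) ⧸ W) = n := by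
    have := W.finrank_quotient_add_finrank
    rw [Module.finrank_fintype_fun_eq_card] at this
    omega
  exact ⟨(tensorQuotEquivQuotSMul C (maximalIdeal R)).trans <|
    (q.quotKerEquivOfSurjective hq).symm.trans <| (Submodule.quotEquivOfEq _ _ hker).trans <|
    (p.quotKerEquivOfSurjective hp).trans <|
    ((Module.finBasisOfFinrankEq _ _ hfin).equivFun.restrictScalars R)⟩

end ResidueFieldVectorSpaces

section TorOfLinearMaps

open IsLocalRing TensorProduct

universe u

variable {R : Type u} [CommRing R]

/-- The short exact sequence in the category of modules given by exact linear maps. -/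
lemma shortExact_ofHom {A B C : Type u} [AddCommGroup A] [AddCommGroup B] [AddCommGroup C]
    [Module R A] [Module R B] [Module R C] {f : A →ₗ[R] B} {g : B →ₗ[R] C}
    (hf : Function.Injective f) (hfg : Function.Exact f g) (hg : Function.Surjective g) :
    (ShortComplex.mk (ModuleCat.ofHom f) (ModuleCat.ofHom g)
      (by rw [← ModuleCat.ofHom_comp, hfg.linearMap_comp_eq_zero]; rfl)).ShortExact where
  exact := (ShortComplex.ShortExact.moduleCat_exact_iff_function_exact _).2 hfg
  mono_f := (ModuleCat.mono_iff_injective _).2 hf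
  epi_g := (ModuleCat.epi_iff_surjective _).2 hg

lemma nonempty_Tor_succ_succ_equiv {A B C : Type u} [AddCommGroup A] [AddCommGroup B]
    [AddCommGroup C] [Module R A] [Module R B] [Module R C] [Module.Flat R B] {f : A →ₗ[R] B}
    {g : B →ₗ[R] C} (hf : Function.Injective f) (hfg : Function.Exact f g)
    (hg : Function.Surjective g) (Y : ModuleCat.{u} R) (n : ℕ) :
    Nonempty ((((Tor (ModuleCat.{u} R) (n + 2)).obj (ModuleCat.of R C)).obj Y) ≃ₗ[R]
      (((Tor (ModuleCat.{u} R) (n + 1)).obj (ModuleCat.of R A)).obj Y)) := by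
  obtain ⟨e⟩ := nonempty_Tor_succ_succ_iso _ _ _ (shortExact_ofHom hf hfg hg) Y n
  exact ⟨e.toLinearEquiv⟩

lemma nonempty_Tor_zero_equiv (A : Type u) [AddCommGroup A] [Module R A] (Y : ModuleCat.{u} R) :
    Nonempty ((((Tor (ModuleCat.{u} R) 0).obj (ModuleCat.of R A)).obj Y) ≃ₗ[R] (A ⊗[R] Y)) :=
  ⟨((MonoidalCategory.tensorLeft (ModuleCat.of R A)).leftDerivedZeroIsoSelf.app Y).toLinearEquiv⟩

lemma nonempty_Tor_one_residueField_equiv [IsLocalRing R] {A B C : Type u} [AddCommGroup A]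
    [AddCommGroup B] [AddCommGroup C] [Module R A] [Module R B] [Module R C] [Module.Flat R B]
    {f : A →ₗ[R] B} {g : B →ₗ[R] C} (hf : Function.Injective f) (hfg : Function.Exact f g)
    (hg : Function.Surjective g) {d p n q : ℕ}
    (hA : Nonempty ((A ⊗[R] ResidueField R) ≃ₗ[R] (Fin n → ResidueField R)))
    (hB : Nonempty ((B ⊗[R] ResidueField R) ≃ₗ[R] (Fin p → ResidueField R)))
    (hC : Nonempty ((C ⊗[R] ResidueField R) ≃ₗ[R] (Fin q → ResidueField R)))
    (h : d + p = n + q) :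
    Nonempty ((((Tor (ModuleCat.{u} R) 1).obj (ModuleCat.of R C)).obj
      (ModuleCat.of R (ResidueField R))) ≃ₗ[R] (Fin d → ResidueField R)) := by
  obtain ⟨a, b, c, ha, hab, hbc, hc⟩ := exists_Tor_one_exact _ _ _ (shortExact_ofHom hf hfg hg)
    (ModuleCat.of R (ResidueField R))
  obtain ⟨⟨eA⟩, ⟨eB⟩, ⟨eC⟩⟩ := And.intro hA (And.intro hB hC)
  exact nonempty_equiv_fin_of_exact a.hom b.hom c.hom ha hab hbc hc eA eB eC h

lemma nonempty_free_tensor_residueField_equiv [IsLocalRing R] (ι : Type*) [Fintype ι] {n : ℕ}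
    (hn : n = Fintype.card ι) :
    Nonempty (((ι → R) ⊗[R] ResidueField R) ≃ₗ[R] (Fin n → ResidueField R)) :=
  nonempty_tensor_residueField_equiv LinearMap.id Function.surjective_id ⊥
    (by rintro x rfl; ext; simp) (by rintro w rfl; exact ⟨0, by simp⟩) (by simp [hn])

end TorOfLinearMaps

section TrimmedResolution

open IsLocalRing

variable {R : Type*} [CommRing R]

lemma pfAux_mem_sq [IsLocalRing R] {N : ℕ} (hN : 3 ≤ N) (M : Matrix (Fin N) (Fin N) R)
    (hM : ∀ a b, M a b ∈ maximalIdeal R) : pfAux M ∈ maximalIdeal R ^ 2 := by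
  unfold pfAux
  split_ifs
  · refine Ideal.sum_mem _ fun σ _ => Ideal.mul_mem_left _ _ ?_
    have h := Ideal.prod_mem_prod (s := Finset.univ.filter fun i : Fin N => (i : ℕ) % 2 = 0)
      (I := fun _ => maximalIdeal R) (x := fun i => M (σ i) (σ (finNext i))) fun i _ => hM _ _
    rw [Finset.prod_const] at h
    refine Ideal.pow_le_pow_right ?_ h
    have hsub : ({⟨0, by omega⟩, ⟨2, by omega⟩} : Finset (Fin N)) ⊆
        Finset.univ.filter fun i : Fin N => (i : ℕ) % 2 = 0 := by
      intro i hi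
      simp only [Finset.mem_insert, Finset.mem_singleton] at hi
      rcases hi with rfl | rfl <;> simp
    refine le_trans ?_ (Finset.card_le_card hsub)
    rw [Finset.card_pair (by simp)]
  · exact zero_mem _

lemma yPf_mem_sq [IsLocalRing R] {m : ℕ} (hm : 4 ≤ m) (T : Matrix (Fin m) (Fin m) R)
    (hT : ∀ a b, T a b ∈ maximalIdeal R) (i : Fin m) : yPf T i ∈ maximalIdeal R ^ 2 := by
  refine Ideal.mul_mem_left _ _ ?_
  rw [pfDel, if_pos (List.nodup_singleton i)]
  refine pfAux_mem_sq ?_ _ fun _ _ => hT _ _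
  rw [Finset.card_sdiff]
  simp
  omega

/-- The index set of the generators of a trimmed ideal: the generators that are kept, and the
products of the trimmed generators with the generators of the maximal ideal. -/
abbrev TrimIndex (m t : ℕ) : Type :=
  {j : Fin m // ¬ (j : ℕ) < t} ⊕ {k : Fin m // (k : ℕ) < t} × Fin 3

lemma card_index_lt {m t : ℕ} (htm : t ≤ m) : Fintype.card {k : Fin m // (k : ℕ) < t} = t := by
  rw [Fintype.card_congr (Fin.castLEquiv htm).symm, Fintype.card_fin]

lemma card_trimIndex {m t : ℕ} (htm : t ≤ m) : Fintype.card (TrimIndex m t) = m + 2 * t := by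
  rw [Fintype.card_sum, Fintype.card_prod, Fintype.card_subtype_compl, card_index_lt htm]
  simp
  omega

variable {m : ℕ} (t : ℕ) (T : Matrix (Fin m) (Fin m) R) (y : Fin m → R) (z : Fin 3 → R)
  (c : Fin m → Fin m → Fin 3 → R)

/-- The generators of the trimmed ideal, as a map from a free module. -/
noncomputable def trimGens : (TrimIndex m t → R) →ₗ[R] R :=
  Fintype.linearCombination R
    (Sum.elim (fun j => y j.1) (fun p : {k : Fin m // (k : ℕ) < t} × Fin 3 => z p.2 * y p.1.1))

lemma trimGens_apply (x : TrimIndex m t → R) :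
    trimGens t y z x = ∑ j, x (Sum.inl j) * y j.1 +
      ∑ k : {k : Fin m // (k : ℕ) < t}, (∑ l, x (Sum.inr (k, l)) * z l) * y k.1 := by
  simp [trimGens, Fintype.linearCombination_apply, Fintype.sum_prod_type, Finset.sum_mul, mul_assoc]

/-- The first syzygies of the generators of the trimmed ideal. -/
noncomputable def trimSyz : (Fin m ⊕ {k : Fin m // (k : ℕ) < t} × Fin 3 → R) →ₗ[R]
    (TrimIndex m t → R) where
  toFun x := Sum.elim (fun j => ∑ i, x (Sum.inl i) * T j.1 i) (fun p =>
    ∑ i, x (Sum.inl i) * c i p.1.1 p.2 + crossProduct (fun l => x (Sum.inr (p.1, l))) z p.2)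
  map_add' x x' := by
    ext (j | ⟨k, l⟩)
    · simp [add_mul, Finset.sum_add_distrib]
    · have := congrFun (congrArg (fun f => f z) (map_add crossProduct
        (fun l => x (Sum.inr (k, l))) (fun l => x' (Sum.inr (k, l))))) l
      simp only [LinearMap.add_apply, Pi.add_apply] at this
      simp only [Sum.elim_inr, Pi.add_apply, add_mul, Finset.sum_add_distrib]
      erw [this]
      ring
  map_smul' r x := by
    ext (j | ⟨k, l⟩)
    · simp [Finset.mul_sum, mul_assoc]
    · have := congrFun (congrArg (fun f => f z) (map_smul crossProduct r
        (fun l => x (Sum.inr (k, l))))) l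
      simp only [LinearMap.smul_apply, Pi.smul_apply] at this
      simp only [Sum.elim_inr, Pi.smul_apply, smul_eq_mul, mul_assoc, RingHom.id_apply, mul_add,
        Finset.mul_sum]
      erw [this]
      rfl

/-- The second syzygies of the generators of the trimmed ideal. -/
noncomputable def trimSyzTwo (φ : {k : Fin m // (k : ℕ) < t} → Fin 3 → R) :
    (Unit ⊕ {k : Fin m // (k : ℕ) < t} → R) →ₗ[R]
      (Fin m ⊕ {k : Fin m // (k : ℕ) < t} × Fin 3 → R) where
  toFun s := Sum.elim (fun i => s (Sum.inl ()) * y i)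
    (fun p => s (Sum.inl ()) * φ p.1 p.2 + s (Sum.inr p.1) * z p.2)
  map_add' s s' := by
    ext (i | p) <;> simp <;> ring
  map_smul' r s := by
    ext (i | p) <;> simp <;> ring

variable {t T y z c}

lemma trimGens_eq_zero_iff
    (hBE1 : Function.Exact (fun f : Fin m → R => fun r : Fin m => ∑ i : Fin m, f i * T r i)
      (fun f : Fin m → R => ∑ i : Fin m, f i * y i)) (x : TrimIndex m t → R) :
    trimGens t y z x = 0 ↔ ∃ u : Fin m → R, (∀ j, x (Sum.inl j) = ∑ i, u i * T j.1 i) ∧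
      ∀ k, ∑ l, x (Sum.inr (k, l)) * z l = ∑ i, u i * T k.1 i := by
  let f : Fin m → R := fun r => if h : (r : ℕ) < t then ∑ l, x (Sum.inr (⟨r, h⟩, l)) * z l
    else x (Sum.inl ⟨r, h⟩)
  have hf : trimGens t y z x = ∑ r, f r * y r := by
    rw [trimGens_apply, ← Fintype.sum_subtype_add_sum_subtype (fun r : Fin m => (r : ℕ) < t),
      add_comm]
    congr 1
    · exact Finset.sum_congr rfl fun k _ => by simp [f, k.2]
    · exact Finset.sum_congr rfl fun j _ => by simp [f, j.2]
  rw [hf, hBE1 f]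
  refine exists_congr fun u => ⟨fun h => ⟨fun j => ?_, fun k => ?_⟩, fun h => funext fun r => ?_⟩
  · have := congrFun h j.1
    simp only [f, dif_neg j.2] at this
    exact this.symm
  · have := congrFun h k.1
    simp only [f, dif_pos k.2] at this
    exact this.symm
  · by_cases hr : (r : ℕ) < t
    · simpa [f, hr] using (h.2 ⟨r, hr⟩).symm
    · simpa [f, hr] using (h.1 ⟨r, hr⟩).symm

lemma sum_sum_mul (hc : ∀ i j : Fin m, T j i = ∑ l : Fin 3, c i j l * z l) (u : Fin m → R)
    (k : Fin m) : ∑ l, (∑ i, u i * c i k l) * z l = ∑ i, u i * T k i := by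
  simp only [hc, Finset.mul_sum, Finset.sum_mul, mul_assoc]
  exact Finset.sum_comm

lemma sum_crossProduct_mul (v : Fin 3 → R) : ∑ l, crossProduct v z l * z l = 0 := by
  simp [Fin.sum_univ_three, cross_apply]
  ring

lemma exact_trimSyz_trimGens
    (hBE1 : Function.Exact (fun f : Fin m → R => fun r : Fin m => ∑ i : Fin m, f i * T r i)
      (fun f : Fin m → R => ∑ i : Fin m, f i * y i))
    (hc : ∀ i j : Fin m, T j i = ∑ l : Fin 3, c i j l * z l)
    (hK : ∀ r : Fin 3 → R, ∑ l, r l * z l = 0 → ∃ v : Fin 3 → R, r = crossProduct v z) :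
    Function.Exact (trimSyz t T z c) (trimGens t y z) := by
  intro x
  rw [trimGens_eq_zero_iff hBE1]
  constructor
  · rintro ⟨u, h1, h2⟩
    have h3 : ∀ k : {k : Fin m // (k : ℕ) < t}, ∃ v : Fin 3 → R,
        (fun l => x (Sum.inr (k, l)) - ∑ i, u i * c i k.1 l) = crossProduct v z := fun k =>
      hK _ (by simp only [sub_mul, Finset.sum_sub_distrib, h2, sum_sum_mul hc, sub_self])
    choose v hv using h3
    refine ⟨Sum.elim u fun p => v p.1 p.2, ?_⟩
    ext (j | ⟨k, l⟩)
    · simp [trimSyz, h1]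
    · have := congrFun (hv k) l
      simp [trimSyz, ← this]
  · rintro ⟨w, rfl⟩
    refine ⟨fun i => w (Sum.inl i), fun j => rfl, fun k => ?_⟩
    simp only [trimSyz, LinearMap.coe_mk, AddHom.coe_mk, Sum.elim_inr, add_mul,
      Finset.sum_add_distrib, sum_crossProduct_mul, add_zero, sum_sum_mul hc]

lemma trimSyz_eq_zero_iff
    (hBE2 : Function.Exact (fun x : R => fun i : Fin m => x * y i)
      (fun f : Fin m → R => fun r : Fin m => ∑ i : Fin m, f i * T r i))
    (hc : ∀ i j : Fin m, T j i = ∑ l : Fin 3, c i j l * z l)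
    (x : Fin m ⊕ {k : Fin m // (k : ℕ) < t} × Fin 3 → R) :
    trimSyz t T z c x = 0 ↔ ∃ s : R, (∀ i, x (Sum.inl i) = s * y i) ∧
      ∀ k : {k : Fin m // (k : ℕ) < t}, crossProduct (fun l => x (Sum.inr (k, l))) z =
        - (s • fun l => ∑ i, y i * c i k.1 l) := by
  constructor
  · intro h
    have h1 : ∀ k : {k : Fin m // (k : ℕ) < t}, ∀ l, crossProduct (fun l => x (Sum.inr (k, l))) z l
        = - ∑ i, x (Sum.inl i) * c i k.1 l := fun k l =>
      (neg_eq_of_add_eq_zero_right (congrFun h (Sum.inr (k, l)))).symm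
    obtain ⟨s, hs⟩ := (hBE2 fun i => x (Sum.inl i)).1 (funext fun r => by
      by_cases hr : (r : ℕ) < t
      · have := sum_crossProduct_mul (z := z) fun l => x (Sum.inr (⟨r, hr⟩, l))
        simp only [h1, neg_mul, Finset.sum_neg_distrib, neg_eq_zero] at this
        rwa [sum_sum_mul hc (fun i => x (Sum.inl i))] at this
      · exact congrFun h (Sum.inl ⟨r, hr⟩))
    have hs' : ∀ i, x (Sum.inl i) = s * y i := fun i => (congrFun hs i).symm
    refine ⟨s, hs', fun k => funext fun l => ?_⟩
    simp [h1, hs', Finset.mul_sum, mul_assoc]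
  · rintro ⟨s, h1, h2⟩
    have h3 := (hBE2 fun i => s * y i).2 ⟨s, rfl⟩
    ext (j | ⟨k, l⟩)
    · simpa [trimSyz, h1] using congrFun h3 j.1
    · simp [trimSyz, h1, h2, Finset.mul_sum, mul_assoc]

lemma exact_trimSyzTwo_trimSyz
    (hBE2 : Function.Exact (fun x : R => fun i : Fin m => x * y i)
      (fun f : Fin m → R => fun r : Fin m => ∑ i : Fin m, f i * T r i))
    (hc : ∀ i j : Fin m, T j i = ∑ l : Fin 3, c i j l * z l)
    (hK : ∀ v : Fin 3 → R, crossProduct v z = 0 → ∃ s : R, v = s • z)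
    {φ : {k : Fin m // (k : ℕ) < t} → Fin 3 → R}
    (hφ : ∀ k, crossProduct (φ k) z = - fun l => ∑ i, y i * c i k.1 l) :
    Function.Exact (trimSyzTwo t y z φ) (trimSyz t T z c) := by
  intro x
  rw [trimSyz_eq_zero_iff hBE2 hc]
  constructor
  · rintro ⟨s, h1, h2⟩
    have h3 : ∀ k : {k : Fin m // (k : ℕ) < t}, ∃ a : R,
        (fun l => x (Sum.inr (k, l))) - s • φ k = a • z := fun k =>
      hK _ (by rw [map_sub, map_smul, LinearMap.sub_apply, LinearMap.smul_apply, h2, hφ]; simp)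
    choose a ha using h3
    refine ⟨Sum.elim (fun _ => s) a, ?_⟩
    ext (i | ⟨k, l⟩)
    · simp [trimSyzTwo, h1]
    · have := congrFun (ha k) l
      simp only [Pi.sub_apply, Pi.smul_apply, smul_eq_mul] at this
      simp [trimSyzTwo, ← this]
  · rintro ⟨w, rfl⟩
    refine ⟨w (Sum.inl ()), fun i => rfl, fun k => ?_⟩
    have : (fun l => trimSyzTwo t y z φ w (Sum.inr (k, l))) =
      w (Sum.inl ()) • φ k + w (Sum.inr k) • z := rfl
    rw [this, map_add, map_smul, map_smul, LinearMap.add_apply, LinearMap.smul_apply,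
      LinearMap.smul_apply, hφ, cross_self, smul_zero, add_zero, smul_neg]

lemma injective_trimSyzTwo (hBE3 : Function.Injective (fun x : R => fun i : Fin m => x * y i))
    (hz : ∀ a, z 0 * a = 0 → a = 0) (φ : {k : Fin m // (k : ℕ) < t} → Fin 3 → R) :
    Function.Injective (trimSyzTwo t y z φ) := by
  rw [injective_iff_map_eq_zero]
  intro s hs
  have h1 : s (Sum.inl ()) = 0 := hBE3 (funext fun i => by
    simpa [trimSyzTwo] using congrFun hs (Sum.inl i))
  ext (_ | k)
  · exact h1
  · exact hz _ (by simpa [trimSyzTwo, h1, mul_comm] using congrFun hs (Sum.inr (k, 0)))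

lemma range_trimGens [IsLocalRing R] (hz : maximalIdeal R = Ideal.span (Set.range z)) :
    LinearMap.range (trimGens t (yPf T) z) = trimIdeal m t T := by
  rw [trimGens, Fintype.range_linearCombination]
  apply le_antisymm
  · rw [Submodule.span_le]
    rintro _ ⟨j | ⟨k, l⟩, rfl⟩
    · exact Ideal.mem_sup_right (Ideal.subset_span ⟨j.1, not_lt.1 j.2, rfl⟩)
    · refine Ideal.mem_sup_left (Ideal.mem_iSup_of_mem k ?_)
      rw [Sum.elim_inr, mul_comm (z _)]
      refine Ideal.mul_mem_mul (Ideal.mem_span_singleton_self _) ?_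
      rw [hz]
      exact Ideal.subset_span ⟨l, rfl⟩
  · refine sup_le (iSup_le fun k => ?_) (Ideal.span_le.2 ?_)
    · rw [hz, Ideal.span_mul_span', Ideal.span_le]
      rintro _ ⟨_, rfl, _, ⟨l, rfl⟩, rfl⟩
      exact Submodule.subset_span ⟨Sum.inr (k, l), mul_comm _ _⟩
    · rintro _ ⟨j, hj, rfl⟩
      exact Submodule.subset_span ⟨Sum.inl ⟨j, not_lt.2 hj⟩, rfl⟩

lemma trimIdeal_le_maximalIdeal [IsLocalRing R] (hy : ∀ i, yPf T i ∈ maximalIdeal R) :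
    trimIdeal m t T ≤ maximalIdeal R := by
  refine sup_le (iSup_le fun k => Ideal.mul_le_right) (Ideal.span_le.2 ?_)
  rintro _ ⟨j, -, rfl⟩
  exact hy j

lemma crossProduct_mem_maximalIdeal [IsLocalRing R] (hz : ∀ l, z l ∈ maximalIdeal R)
    (v : Fin 3 → R) (l : Fin 3) : crossProduct v z l ∈ maximalIdeal R := by
  have h : ∀ i j, v i * z j ∈ maximalIdeal R := fun i j => Ideal.mul_mem_left _ _ (hz j)
  fin_cases l <;> simp [cross_apply] <;> exact sub_mem (h _ _) (h _ _)

lemma mem_maximalIdeal_of_crossProduct_mem_sq [IsNoetherianRing R] [IsLocalRing R]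
    (hz : maximalIdeal R = Ideal.span (Set.range z))
    (hdim : ((3 : ℕ) : WithBot ℕ∞) ≤ ringKrullDim R) (v : Fin 3 → R)
    (hv : ∀ l, crossProduct v z l ∈ maximalIdeal R ^ 2) (l : Fin 3) : v l ∈ maximalIdeal R := by
  have h0 := mem_maximalIdeal_of_sum_mul_mem_sq z hz hdim ![- v 1, v 0, 0] (by
    convert hv 2 using 1
    simp [Fin.sum_univ_three, cross_apply]
    ring)
  have h1 := mem_maximalIdeal_of_sum_mul_mem_sq z hz hdim ![v 2, 0, - v 0] (by
    convert hv 1 using 1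
    simp [Fin.sum_univ_three, cross_apply]
    ring)
  fin_cases l
  · exact h0 1
  · exact neg_mem_iff.1 (h0 0)
  · exact h1 0

lemma mem_maximalIdeal_of_trimSyz_eq_zero [IsNoetherianRing R] [IsLocalRing R]
    (hz : maximalIdeal R = Ideal.span (Set.range z))
    (hdim : ((3 : ℕ) : WithBot ℕ∞) ≤ ringKrullDim R)
    (hy : ∀ i, y i ∈ maximalIdeal R ^ 2)
    (hBE2 : Function.Exact (fun x : R => fun i : Fin m => x * y i)
      (fun f : Fin m → R => fun r : Fin m => ∑ i : Fin m, f i * T r i))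
    (hc : ∀ i j : Fin m, T j i = ∑ l : Fin 3, c i j l * z l)
    (x : Fin m ⊕ {k : Fin m // (k : ℕ) < t} × Fin 3 → R) (hx : trimSyz t T z c x = 0)
    (i) : x i ∈ maximalIdeal R := by
  obtain ⟨s, h1, h2⟩ := (trimSyz_eq_zero_iff hBE2 hc x).1 hx
  rcases i with i | ⟨k, l⟩
  · rw [h1]
    exact Ideal.mul_mem_left _ _ (Ideal.pow_le_self two_ne_zero (hy i))
  · refine mem_maximalIdeal_of_crossProduct_mem_sq hz hdim (fun l => x (Sum.inr (k, l)))
      (fun l => ?_) l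
    rw [h2]
    exact neg_mem (Ideal.mul_mem_left _ _
      (Ideal.sum_mem _ fun i _ => Ideal.mul_mem_right _ _ (hy i)))

lemma residue_trimSyz [IsLocalRing R] (hz : ∀ l, z l ∈ maximalIdeal R)
    (hT : ∀ a b, T a b ∈ maximalIdeal R)
    (x : Fin m ⊕ {k : Fin m // (k : ℕ) < t} × Fin 3 → R) :
    (fun i => residue R (trimSyz t T z c x i)) =
      Sum.elim (fun _ => 0) ((Matrix.of fun p : {k : Fin m // (k : ℕ) < t} × Fin 3 => fun i : Fin m =>
        residue R (c i p.1.1 p.2)).mulVec fun i => residue R (x (Sum.inl i))) := by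
  ext (j | ⟨k, l⟩)
  · have h : ∑ i, x (Sum.inl i) * T j.1 i ∈ maximalIdeal R :=
      Ideal.sum_mem _ fun i _ => Ideal.mul_mem_left _ _ (hT _ _)
    exact (residue_eq_zero_iff _).2 h
  · have := (residue_eq_zero_iff _).2
      (crossProduct_mem_maximalIdeal hz (fun l => x (Sum.inr (k, l))) l)
    simp [trimSyz, this, Matrix.mulVec, dotProduct, mul_comm]

open TensorProduct in
lemma nonempty_range_trimGens_tensor_equiv [IsLocalRing R] (htm : t ≤ m)
    (hz : ∀ l, z l ∈ maximalIdeal R) (hT : ∀ a b, T a b ∈ maximalIdeal R)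
    (hex : Function.Exact (trimSyz t T z c) (trimGens t y z))
    {J : Ideal R} (g : (TrimIndex m t → R) →ₗ[R] J) (hg : Function.Surjective g)
    (hgJ : ∀ x, (g x : R) = trimGens t y z x) {n : ℕ}
    (hn : n + (Matrix.of fun p : {k : Fin m // (k : ℕ) < t} × Fin 3 => fun i : Fin m =>
      residue R (c i p.1.1 p.2)).rank = m + 2 * t) :
    Nonempty ((J ⊗[R] ResidueField R) ≃ₗ[R] (Fin n → ResidueField R)) := by
  let Q := Matrix.of fun p : {k : Fin m // (k : ℕ) < t} × Fin 3 => fun i : Fin m =>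
      residue R (c i p.1.1 p.2)
  let E : ({k : Fin m // (k : ℕ) < t} × Fin 3 → ResidueField R) →ₗ[ResidueField R]
      (TrimIndex m t → ResidueField R) :=
    (LinearEquiv.sumArrowLequivProdArrow _ _ _ _).symm.toLinearMap ∘ₗ LinearMap.inr _ _ _
  have hE : Function.Injective E := by
    rw [LinearMap.coe_comp]
    exact (LinearEquiv.injective _).comp LinearMap.inr_injective
  have hres : ∀ x, (fun i => residue R (trimSyz t T z c x i)) =
      E (Q.mulVecLin fun i => residue R (x (Sum.inl i))) := residue_trimSyz hz hT
  have hg0 : ∀ x, g x = 0 ↔ trimGens t y z x = 0 := fun x => by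
    rw [← hgJ, ZeroMemClass.coe_eq_zero]
  refine nonempty_tensor_residueField_equiv g hg ((LinearMap.range Q.mulVecLin).map E) ?_ ?_ ?_
  · intro x hx
    obtain ⟨w, rfl⟩ := (hex x).1 ((hg0 x).1 hx)
    rw [hres]
    exact Submodule.mem_map_of_mem ⟨_, rfl⟩
  · rintro _ ⟨_, ⟨u, rfl⟩, rfl⟩
    choose u' hu' using fun i => residue_surjective (u i)
    refine ⟨trimSyz t T z c (Sum.elim u' 0), (hg0 _).2 ((hex _).2 ⟨_, rfl⟩), fun i => ?_⟩
    rw [congrFun (hres _) i]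
    simp [hu']
  · rw [card_trimIndex htm, ← hn,
      ← (Submodule.equivMapOfInjective E hE (LinearMap.range Q.mulVecLin)).finrank_eq]
    rfl

end TrimmedResolution
/-- Theorem 5.6 of the paper (the statement about the format): over a regular local ring
`(R,𝔪,𝕜)` of Krull dimension 3 with `𝔪 = (z₁,z₂,z₃)`, if the ideal `J` is obtained by
trimming the first `t` pfaffian generators of the Gorenstein ideal of the odd-sized (`m ≥ 5`)
skew-symmetric matrix `T`, then `R/J` has Betti numbers `1`, `m + 2t − ρ`, `m + 3t − ρ`,
`1 + t` and `Tor_q^R(R/J,𝕜) = 0` for `q ≥ 4`, where `ρ` is the rank of the reduction of the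
matrix `Q₁` modulo `𝔪`.  The `𝕜`-dimension of `Tor_q^R(R/J,𝕜)` being `b` is expressed by an
`R`-linear isomorphism `Tor_q^R(R/J,𝕜) ≃ 𝕜^b`. -/
theorem trim_format {R : Type} [CommRing R] [IsNoetherianRing R] [IsLocalRing R]
    (hdim : ringKrullDim R = 3)
    (z : Fin 3 → R) (hz : IsLocalRing.maximalIdeal R = Ideal.span {z 0, z 1, z 2})
    (m : ℕ) (hm5 : 5 ≤ m) (hodd : Odd m)
    (T : Matrix (Fin m) (Fin m) R)
    (hskew : ∀ a b, T b a = - T a b) (hdiag : ∀ a, T a a = 0)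
    (hTmem : ∀ a b, T a b ∈ IsLocalRing.maximalIdeal R)
    -- the Buchsbaum–Eisenbud complex `0 → R → R^m → R^m → R` is exact in positive degrees:
    (hBE3 : Function.Injective (fun x : R => fun i : Fin m => x * yPf T i))
    (hBE2 : Function.Exact (fun x : R => fun i : Fin m => x * yPf T i)
      (fun f : Fin m → R => fun r : Fin m => ∑ i : Fin m, f i * T r i))
    (hBE1 : Function.Exact (fun f : Fin m → R => fun r : Fin m => ∑ i : Fin m, f i * T r i)
      (fun f : Fin m → R => ∑ i : Fin m, f i * yPf T i))
    (t : ℕ) (ht1 : 1 ≤ t) (htm : t ≤ m)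
    (c : Fin m → Fin m → Fin 3 → R)
    (hc : ∀ i j : Fin m, T j i = ∑ l : Fin 3, c i j l * z l)
    (ρ : ℕ)
    (hρ : ρ = (Matrix.of fun p : {k : Fin m // (k : ℕ) < t} × Fin 3 => fun i : Fin m =>
      IsLocalRing.residue R (c i p.1.1 p.2)).rank) :
    Nonempty ((((Tor (ModuleCat R) 0).obj (ModuleCat.of R (R ⧸ trimIdeal m t T))).obj
        (ModuleCat.of R (IsLocalRing.ResidueField R))) ≃ₗ[R]
        (Fin 1 → IsLocalRing.ResidueField R)) ∧
    Nonempty ((((Tor (ModuleCat R) 1).obj (ModuleCat.of R (R ⧸ trimIdeal m t T))).obj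
        (ModuleCat.of R (IsLocalRing.ResidueField R))) ≃ₗ[R]
        (Fin (m + 2 * t - ρ) → IsLocalRing.ResidueField R)) ∧
    Nonempty ((((Tor (ModuleCat R) 2).obj (ModuleCat.of R (R ⧸ trimIdeal m t T))).obj
        (ModuleCat.of R (IsLocalRing.ResidueField R))) ≃ₗ[R]
        (Fin (m + 3 * t - ρ) → IsLocalRing.ResidueField R)) ∧
    Nonempty ((((Tor (ModuleCat R) 3).obj (ModuleCat.of R (R ⧸ trimIdeal m t T))).obj
        (ModuleCat.of R (IsLocalRing.ResidueField R))) ≃ₗ[R]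
        (Fin (1 + t) → IsLocalRing.ResidueField R)) ∧
    ∀ q : ℕ, 4 ≤ q →
      Subsingleton (((Tor (ModuleCat R) q).obj (ModuleCat.of R (R ⧸ trimIdeal m t T))).obj
        (ModuleCat.of R (IsLocalRing.ResidueField R))) := by
  have hz' : IsLocalRing.maximalIdeal R = Ideal.span (Set.range z) := by
    rw [hz]
    congr 1
    ext x
    simp [Fin.exists_fin_succ, eq_comm]
  have hdim' : ((3 : ℕ) : WithBot ℕ∞) ≤ ringKrullDim R := hdim.ge
  have hzm : ∀ l, z l ∈ IsLocalRing.maximalIdeal R := fun l => hz' ▸ Ideal.subset_span ⟨l, rfl⟩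
  have hy := yPf_mem_sq (by omega) T hTmem
  obtain ⟨h0, h1, h2⟩ := regular_generators_three z hz' hdim'
  obtain ⟨hK1, hK2⟩ := koszul_exact_three z h0 h1 h2
  have hφ : ∀ k : {k : Fin m // (k : ℕ) < t}, ∃ v : Fin 3 → R,
      crossProduct v z = - fun l => ∑ i, yPf T i * c i k.1 l := by
    intro k
    obtain ⟨v, hv⟩ := hK1 (- fun l => ∑ i, yPf T i * c i k.1 l) (by
      simp only [Pi.neg_apply, neg_mul, Finset.sum_neg_distrib, neg_eq_zero, sum_sum_mul hc]
      exact congrFun ((hBE2 fun i => yPf T i).2 ⟨1, by simp⟩) k.1)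
    exact ⟨v, hv.symm⟩
  choose φ hφ using hφ
  have hexG := exact_trimSyz_trimGens (t := t) hBE1 hc hK1
  have hexS := exact_trimSyzTwo_trimSyz hBE2 hc hK2 hφ
  have hinj := injective_trimSyzTwo hBE3 h0 φ
  -- the presentation of `J`
  let J := trimIdeal m t T
  have hrange : LinearMap.range (trimGens t (yPf T) z) = J := range_trimGens hz'
  let g : (TrimIndex m t → R) →ₗ[R] J :=
    (trimGens t (yPf T) z).codRestrict J fun x => hrange ▸ LinearMap.mem_range_self _ x
  have hg : Function.Surjective g := by
    rintro ⟨a, ha⟩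
    obtain ⟨x, rfl⟩ := hrange.symm ▸ ha
    exact ⟨x, rfl⟩
  let N := LinearMap.ker (trimGens t (yPf T) z)
  have hNg : Function.Exact N.subtype g := fun x => by
    rw [Subtype.ext_iff]
    simp [N, g]
  let s : (Fin m ⊕ {k : Fin m // (k : ℕ) < t} × Fin 3 → R) →ₗ[R] N :=
    (trimSyz t T z c).codRestrict N fun x => (hexG _).2 ⟨x, rfl⟩
  have hs : Function.Surjective s := by
    rintro ⟨x, hx⟩
    obtain ⟨w, rfl⟩ := (hexG x).1 hx
    exact ⟨w, rfl⟩
  have hs0 : ∀ x, s x = 0 ↔ trimSyz t T z c x = 0 := fun x => Subtype.ext_iff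
  have hSs : Function.Exact (trimSyzTwo t (yPf T) z φ) s := fun x => (hs0 x).trans (hexS x)
  have hJQ : Function.Exact J.subtype J.mkQ := LinearMap.exact_subtype_mkQ J
  -- the ranks
  have hcard := card_index_lt htm
  have hρ1 : ρ ≤ m := hρ ▸ (Matrix.rank_le_card_width _).trans (by simp)
  have dimF1 := nonempty_free_tensor_residueField_equiv (R := R) (TrimIndex m t)
    (card_trimIndex htm).symm
  have dimF2 := nonempty_free_tensor_residueField_equiv (R := R)
    (Fin m ⊕ {k : Fin m // (k : ℕ) < t} × Fin 3) (n := m + 3 * t)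
    (by simp only [Fintype.card_sum, Fintype.card_prod, hcard, Fintype.card_fin]; omega)
  have dimF3 := nonempty_free_tensor_residueField_equiv (R := R)
    (Unit ⊕ {k : Fin m // (k : ℕ) < t}) (n := 1 + t)
    (by simp only [Fintype.card_sum, hcard, Fintype.card_unit])
  have dimJ := nonempty_range_trimGens_tensor_equiv htm hzm hTmem hexG g hg (fun _ => rfl)
    (n := m + 2 * t - ρ) (by omega)
  have dimN := nonempty_tensor_residueField_equiv s hs ⊥ (n := m + 3 * t)
    (fun x hx => funext fun i => (IsLocalRing.residue_eq_zero_iff _).2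
      (mem_maximalIdeal_of_trimSyz_eq_zero hz' hdim' hy hBE2 hc x ((hs0 x).1 hx) i))
    (by rintro w rfl; exact ⟨0, by simp⟩)
    (by
      simp only [finrank_bot, Fintype.card_sum, Fintype.card_prod, hcard, Fintype.card_fin]
      omega)
  have dimR : Nonempty (TensorProduct R R (IsLocalRing.ResidueField R) ≃ₗ[R]
      (Fin 1 → IsLocalRing.ResidueField R)) :=
    ⟨(TensorProduct.lid R _).trans (LinearEquiv.funUnique (Fin 1) R _).symm⟩
  have dimQ := nonempty_tensor_residueField_equiv (ι := Unit)
    (J.mkQ ∘ₗ LinearMap.proj ()) (J.mkQ_surjective.comp (LinearMap.proj_surjective ())) ⊥ (n := 1)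
    (fun x hx => funext fun i => (IsLocalRing.residue_eq_zero_iff _).2
      (trimIdeal_le_maximalIdeal (fun i => Ideal.pow_le_self two_ne_zero (hy i))
        ((Submodule.Quotient.mk_eq_zero J).1 hx)))
    (by rintro w rfl; exact ⟨0, by simp⟩) (by simp)
  have shiftQ := fun n => nonempty_Tor_succ_succ_equiv J.subtype_injective hJQ J.mkQ_surjective
    (ModuleCat.of R (IsLocalRing.ResidueField R)) n
  have shiftJ := fun n => nonempty_Tor_succ_succ_equiv N.subtype_injective hNg hg
    (ModuleCat.of R (IsLocalRing.ResidueField R)) n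
  have shiftN := fun n => nonempty_Tor_succ_succ_equiv hinj hSs hs
    (ModuleCat.of R (IsLocalRing.ResidueField R)) n
  refine ⟨?_, ?_, ?_, ?_, ?_⟩
  · obtain ⟨e⟩ := nonempty_Tor_zero_equiv (R ⧸ J)
      (ModuleCat.of R (IsLocalRing.ResidueField R))
    exact dimQ.map e.trans
  · exact nonempty_Tor_one_residueField_equiv J.subtype_injective hJQ J.mkQ_surjective dimJ dimR
      dimQ (by omega)
  · obtain ⟨e⟩ := shiftQ 0
    exact (nonempty_Tor_one_residueField_equiv N.subtype_injective hNg hg dimN dimF1 dimJ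
      (by omega)).map e.trans
  · obtain ⟨e⟩ := shiftQ 1
    obtain ⟨e'⟩ := shiftJ 0
    exact (nonempty_Tor_one_residueField_equiv hinj hSs hs dimF3 dimF2 dimN
      (by omega)).map (e.trans e').trans
  · intro q hq
    obtain ⟨n, rfl⟩ := Nat.exists_eq_add_of_le' hq
    obtain ⟨e⟩ := shiftQ (n + 2)
    obtain ⟨e'⟩ := shiftJ (n + 1)
    obtain ⟨e''⟩ := shiftN n
    have := ModuleCat.subsingleton_of_isZero (isZero_Tor_succ_of_flat (ModuleCat.of R
      (Unit ⊕ {k : Fin m // (k : ℕ) < t} → R)) (ModuleCat.of R (IsLocalRing.ResidueField R)) n)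
    exact ((e.trans e').trans e'').injective.subsingleton
end
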